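/- arXiv:1401.0285 — 6 statements merged into one kernel-verified Lean document; each statement's English description precedes it below -/
import Mathlib

section
/- (Theorem 2.) Let n ≥ 1 be an integer and let α, β, γ > 0 satisfy 0 < β < α, γ > (n+2)α and 2γ + (n+2)α < 1. Assume the families (u_ε), (X_ε), (v_ε), (w_ε) are as in Theorem 1 (u_ε bounded by M₁, 2π-periodic in x, C¹ in x with |∂ₓu_ε| ≤ C_δ/ε^β on [0,δ]; X_ε the 2π-periodic solution of the discrete transport ODE with velocity u_ε, step ε, and uniformly L¹-bounded 2π-periodic initial data; v_ε = X_ε * φ_{ε^α}; w_ε the 2π-periodic solution of ∂ₜw_ε = (1/ε)[w_ε u_ε⁺(x−ε,t) − w_ε|u_ε|(x,t) + w_ε u_ε⁻(x+ε,t)] − n v_ε^{n−1}∂ₓv_ε with uniformly L¹-bounded 2π-periodic initial data), and that (Z_ε) are continuously differentiable 2π-periodic curves in C_b(ℝ) with uniformly L¹-bounded 2π-periodic initial data Z₀ε and ∂ₜZ_ε(x,t) = (1/ε)[Z_ε(x−ε,t)u_ε(x−ε,t)⁺ − Z_ε(x,t)|u_ε(x,t)| + Z_ε(x+ε,t)u_ε(x+ε,t)⁻]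 − ∂ₓ[(v_ε(·,t)·w_ε(·,t)) * φ_{ε^γ}](x). Then for every ψ ∈ C_c^∞(ℝ) and every δ > 0, sup_{t∈[0,δ]} |∫_ℝ (∂ₜZ_ε(x,t)ψ(x) − u_ε(x,t)Z_ε(x,t)ψ'(x) − v_ε(x,t)w_ε(x,t)ψ'(x)) dx| → 0 as ε → 0; i.e. (u_ε, v_ε, w_ε, Z_ε) is a weak asymptotic method for the system consisting of the three equations of Theorem 1 together with ∂ₜZ + ∂ₓ(uZ) + ∂ₓ(vw) = 0. -/
open MeasureTheory Set Real

/-- `X : [0,∞) → C_b(ℝ)` is a continuously differentiable solution of the discrete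
transport ODE with velocity `u` (written `u x t`) and step `ε`. -/
def IsDiscreteTransportSol (ε : ℝ) (u : ℝ → ℝ → ℝ)
    (X : ℝ → BoundedContinuousFunction ℝ ℝ) : Prop :=
  ∃ X' : ℝ → BoundedContinuousFunction ℝ ℝ,
    ContinuousOn X' (Ici 0) ∧
    (∀ t ∈ Ici (0:ℝ), HasDerivWithinAt X (X' t) (Ici 0) t) ∧
    (∀ t ∈ Ici (0:ℝ), ∀ x : ℝ,
      X' t x = ε⁻¹ * (X t (x - ε) * max (u (x - ε) t) 0
        - X t x * |u x t| + X t (x + ε) * max (-(u (x + ε) t)) 0))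

open Filter Topology

/-- The `L¹` norm of a `2π`-periodic function over one period. -/
noncomputable def periodNorm (f : ℝ → ℝ) : ℝ := ∫ x in (-π)..π, |f x|

/-- The convolution `f * φ_h`, where `φ_h y = h⁻¹ φ (y / h)`. -/
noncomputable def mollify (φ : ℝ → ℝ) (h : ℝ) (f : ℝ → ℝ) (x : ℝ) : ℝ :=
  ∫ y, f (x - y) * (h⁻¹ * φ (y / h))

/-- The upwind discretization of `-∂ₓ (u f)` with step `ε`. -/
noncomputable def upwind (ε : ℝ) (u f : ℝ → ℝ) (x : ℝ) : ℝ :=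
  ε⁻¹ * (f (x - ε) * max (u (x - ε)) 0 - f x * |u x| + f (x + ε) * max (-(u (x + ε))) 0)

lemma neg_pi_le_pi : -π ≤ π := by linarith [pi_pos]

lemma periodNorm_nonneg (f : ℝ → ℝ) : 0 ≤ periodNorm f :=
  intervalIntegral.integral_nonneg neg_pi_le_pi fun _ _ => abs_nonneg _

lemma periodNorm_le_of_abs_le {f g : ℝ → ℝ} (hf : Continuous f) (hg : Continuous g)
    (h : ∀ x, |f x| ≤ g x) : periodNorm f ≤ ∫ x in (-π)..π, g x :=
  intervalIntegral.integral_mono_on neg_pi_le_pi (hf.abs.intervalIntegrable _ _)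
    (hg.intervalIntegrable _ _) fun x _ => h x

lemma Function.Periodic.integral_comp_add_eq {g : ℝ → ℝ} (hg : Function.Periodic g (2 * π))
    (a : ℝ) : ∫ x in (-π)..π, g (x + a) = ∫ x in (-π)..π, g x := by
  have := hg.intervalIntegral_add_eq (-π + a) (-π)
  rw [intervalIntegral.integral_comp_add_right]
  convert this using 2 <;> ring

lemma Function.Periodic.integral_comp_sub_eq {g : ℝ → ℝ} (hg : Function.Periodic g (2 * π))
    (a : ℝ) : ∫ x in (-π)..π, g (x - a) = ∫ x in (-π)..π, g x := by
  simpa only [sub_eq_add_neg] using hg.integral_comp_add_eq (-a)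

lemma Function.Periodic.abs {g : ℝ → ℝ} {T : ℝ} (hg : Function.Periodic g T) :
    Function.Periodic (fun x => |g x|) T := fun x => by simp only [hg x]

lemma integral_abs_le_periodNorm {f : ℝ → ℝ} (hf : Continuous f)
    (hp : Function.Periodic f (2 * π)) (m : ℕ) :
    ∫ x in (-(m : ℝ))..m, |f x| ≤ m * periodNorm f := by
  have h1 := hp.abs.intervalIntegral_add_zsmul_eq m (-(m * π))
    fun _ _ => hf.abs.intervalIntegrable _ _
  have h2 := hp.abs.intervalIntegral_add_eq (-(m * π)) (-π)
  rw [h2] at h1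
  have e1 : -(m * π) + (m : ℤ) • (2 * π) = m * π := by simp; ring
  have e2 : -π + 2 * π = π := by ring
  rw [e1, e2] at h1
  simp only [zsmul_eq_mul, Int.cast_natCast] at h1
  rw [periodNorm, ← h1]
  have hm : (m : ℝ) ≤ m * π := le_mul_of_one_le_right (by positivity) (by linarith [pi_gt_three])
  have hm0 : (0 : ℝ) ≤ m := by positivity
  exact intervalIntegral.integral_mono_interval (by linarith) (by linarith) hm
    (Eventually.of_forall fun _ => abs_nonneg _) (hf.abs.intervalIntegrable _ _)

lemma integral_eq_intervalIntegral_of_eq_zero {F : ℝ → ℝ} {m : ℕ}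
    (hF : ∀ x, (m : ℝ) ≤ |x| → F x = 0) : ∫ x, F x = ∫ x in (-(m : ℝ))..m, F x := by
  refine (intervalIntegral.integral_eq_integral_of_support_subset fun x hx => ?_).symm
  have h : |x| < m := by
    by_contra h
    exact hx (hF x (not_lt.1 h))
  exact ⟨(abs_lt.1 h).1, (abs_lt.1 h).2.le⟩

lemma abs_integral_le_mul_periodNorm {f F : ℝ → ℝ} (hf : Continuous f)
    (hp : Function.Periodic f (2 * π)) {c : ℝ} (hc : 0 ≤ c) {m : ℕ}
    (hF : ∀ x, (m : ℝ) ≤ |x| → F x = 0) (hle : ∀ x, |F x| ≤ c * |f x|) :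
    |∫ x, F x| ≤ c * m * periodNorm f := by
  have hm0 : (0 : ℝ) ≤ m := by positivity
  rw [integral_eq_intervalIntegral_of_eq_zero hF]
  calc |∫ x in (-(m : ℝ))..m, F x| ≤ ∫ x in (-(m : ℝ))..m, c * |f x| := by
        rw [← norm_eq_abs]
        exact intervalIntegral.norm_integral_le_of_norm_le (by linarith)
          (Eventually.of_forall fun x _ => hle x) ((hf.abs.const_mul c).intervalIntegrable _ _)
    _ = c * ∫ x in (-(m : ℝ))..m, |f x| := intervalIntegral.integral_const_mul _ _
    _ ≤ c * (m * periodNorm f) := by gcongr; exact integral_abs_le_periodNorm hf hp m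
    _ = c * m * periodNorm f := by ring

lemma HasCompactSupport.exists_nat_forall_eq_zero {φ : ℝ → ℝ} (hφ : HasCompactSupport φ) :
    ∃ m : ℕ, ∀ x, (m : ℝ) ≤ |x| → φ x = 0 := by
  obtain ⟨R, hR⟩ := hφ.isCompact.isBounded.subset_closedBall 0
  obtain ⟨m, hm⟩ := exists_nat_gt R
  refine ⟨m, fun x hx => ?_⟩
  by_contra h
  have := hR (subset_tsupport _ h)
  rw [Metric.mem_closedBall, dist_zero_right, norm_eq_abs] at this
  linarith

lemma hasCompactSupport_of_eq_zero {F : ℝ → ℝ} {m : ℝ}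
    (hF : ∀ x, m ≤ |x| → F x = 0) : HasCompactSupport F := by
  refine HasCompactSupport.intro (isCompact_Icc (a := -m) (b := m)) fun x hx => hF x ?_
  by_contra h
  exact hx (abs_le.1 (not_le.1 h).le)

lemma abs_integral_comp_sub_mul_le {f K : ℝ → ℝ} (hf : Continuous f)
    (hp : Function.Periodic f (2 * π)) {B : ℝ} {m : ℕ}
    (hK0 : ∀ x, (m : ℝ) ≤ |x| → K x = 0) (hB : ∀ x, |K x| ≤ B) (x : ℝ) :
    |∫ y, f (x - y) * K y| ≤ B * m * periodNorm f := by
  have hB0 : 0 ≤ B := (abs_nonneg _).trans (hB 0)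
  have hp' : Function.Periodic (fun y => f (x - y)) (2 * π) := fun y => by
    have := hp (x - (y + 2 * π))
    simp only [← this]
    congr 1; ring
  have h := abs_integral_le_mul_periodNorm (f := fun y => f (x - y))
    (F := fun y => f (x - y) * K y) (by fun_prop) hp' hB0 (m := m)
    (fun y hy => by simp [hK0 y hy])
    (fun y => by rw [abs_mul, mul_comm]; gcongr; exact hB y)
  have e : periodNorm (fun y => f (x - y)) = periodNorm f := by
    have h1 := hp.abs.intervalIntegral_add_eq (x - π) (-π)
    rw [periodNorm, intervalIntegral.integral_comp_sub_left (fun z => |f z|), periodNorm]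
    convert h1 using 2 <;> ring
  rwa [e] at h

lemma periodNorm_integral_comp_sub_mul_le {f K : ℝ → ℝ} (hf : Continuous f)
    (hp : Function.Periodic f (2 * π)) (hK : Continuous K) {m : ℕ}
    (hK0 : ∀ x, (m : ℝ) ≤ |x| → K x = 0) :
    periodNorm (fun x => ∫ y, f (x - y) * K y) ≤ (∫ y, |K y|) * periodNorm f := by
  have hm0 : (0 : ℝ) ≤ m := by positivity
  have hint : ∀ x, ∫ y, f (x - y) * K y = ∫ y in (-(m : ℝ))..m, f (x - y) * K y := fun x =>
    integral_eq_intervalIntegral_of_eq_zero fun y hy => by simp [hK0 y hy]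
  simp only [hint]
  have hc : Continuous fun x => ∫ y in (-(m : ℝ))..m, f (x - y) * K y :=
    intervalIntegral.continuous_parametric_intervalIntegral_of_continuous' (by fun_prop) _ _
  have hc' : Continuous fun x => ∫ y in (-(m : ℝ))..m, |f (x - y)| * |K y| :=
    intervalIntegral.continuous_parametric_intervalIntegral_of_continuous' (by fun_prop) _ _
  calc _ ≤ ∫ x in (-π)..π, ∫ y in (-(m : ℝ))..m, |f (x - y)| * |K y| := by
        refine periodNorm_le_of_abs_le hc hc' fun x => ?_
        refine (intervalIntegral.abs_integral_le_integral_abs (by linarith)).trans_eq ?_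
        simp only [abs_mul]
    _ = ∫ y in (-(m : ℝ))..m, ∫ x in (-π)..π, |f (x - y)| * |K y| := by
        refine intervalIntegral_intervalIntegral_swap ?_
        have hcont : Continuous (Function.uncurry fun x y => |f (x - y)| * |K y|) := by fun_prop
        refine (hcont.continuousOn.integrableOn_compact
          ((isCompact_uIcc (a := -π) (b := π)).prod (isCompact_uIcc (a := -(m : ℝ)) (b := m)))).mono_set
          (Set.prod_mono uIoc_subset_uIcc uIoc_subset_uIcc)
    _ = ∫ y in (-(m : ℝ))..m, |K y| * periodNorm f := by
        refine intervalIntegral.integral_congr fun y _ => ?_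
        simp only [intervalIntegral.integral_mul_const]
        rw [hp.abs.integral_comp_sub_eq y, mul_comm, periodNorm]
    _ = (∫ y, |K y|) * periodNorm f := by
        rw [intervalIntegral.integral_mul_const,
          integral_eq_intervalIntegral_of_eq_zero (F := fun y => |K y|) (m := m)
            fun y hy => by simp [hK0 y hy]]

lemma scaled_eq_zero {φ : ℝ → ℝ} {m : ℕ} (hφ0 : ∀ x, (m : ℝ) ≤ |x| → φ x = 0) {h : ℝ}
    (h0 : 0 < h) {y : ℝ} (hy : h * m ≤ |y|) : h⁻¹ * φ (y / h) = 0 := by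
  rw [hφ0, mul_zero]
  rw [abs_div, abs_of_pos h0, le_div_iff₀ h0, mul_comm]
  exact hy

lemma scaled_eq_zero_of_le_one {φ : ℝ → ℝ} {m : ℕ} (hφ0 : ∀ x, (m : ℝ) ≤ |x| → φ x = 0) {h : ℝ}
    (h0 : 0 < h) (h1 : h ≤ 1) (y : ℝ) (hy : (m : ℝ) ≤ |y|) : h⁻¹ * φ (y / h) = 0 :=
  scaled_eq_zero hφ0 h0 ((mul_le_of_le_one_left (by positivity) h1).trans hy)

lemma integral_scaled (g : ℝ → ℝ) {h : ℝ} (h0 : 0 < h) :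
    ∫ y, h⁻¹ * g (y / h) = ∫ y, g y := by
  rw [integral_const_mul, Measure.integral_comp_div g h, abs_of_pos h0, smul_eq_mul,
    inv_mul_cancel_left₀ h0.ne']

lemma periodic_mollify {φ f : ℝ → ℝ} (hp : Function.Periodic f (2 * π)) (h : ℝ) :
    Function.Periodic (mollify φ h f) (2 * π) := fun x => by
  simp only [mollify]
  congr 1 with y
  rw [add_sub_right_comm, hp]

lemma exists_abs_mollify_le {φ : ℝ → ℝ} (hφ : Continuous φ) (hφc : HasCompactSupport φ) :
    ∃ A, 0 ≤ A ∧ ∀ h, 0 < h → h ≤ 1 → ∀ f : ℝ → ℝ, Continuous f →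
      Function.Periodic f (2 * π) → ∀ x, |mollify φ h f x| ≤ A * h⁻¹ * periodNorm f := by
  obtain ⟨m, hm⟩ := hφc.exists_nat_forall_eq_zero
  obtain ⟨B, hB⟩ := hφc.exists_bound_of_continuous hφ
  have hB0 : 0 ≤ B := (norm_nonneg _).trans (hB 0)
  refine ⟨B * m, by positivity, fun h h0 h1 f hf hp x => ?_⟩
  refine (abs_integral_comp_sub_mul_le hf hp (B := h⁻¹ * B)
    (scaled_eq_zero_of_le_one hm h0 h1) (fun y => ?_) x).trans_eq (by ring)
  rw [abs_mul, abs_of_pos (inv_pos.2 h0)]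
  exact mul_le_mul_of_nonneg_left (hB _) (inv_pos.2 h0).le

lemma periodNorm_mollify_le {φ : ℝ → ℝ} (hφ : Continuous φ) (hφc : HasCompactSupport φ) {h : ℝ}
    (h0 : 0 < h) (h1 : h ≤ 1) {f : ℝ → ℝ} (hf : Continuous f) (hp : Function.Periodic f (2 * π)) :
    periodNorm (mollify φ h f) ≤ (∫ y, |φ y|) * periodNorm f := by
  obtain ⟨m, hm⟩ := hφc.exists_nat_forall_eq_zero
  have := periodNorm_integral_comp_sub_mul_le hf hp (K := fun y => h⁻¹ * φ (y / h)) (by fun_prop)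
    (scaled_eq_zero_of_le_one hm h0 h1)
  simp only [abs_mul, abs_of_pos (inv_pos.2 h0)] at this
  rwa [integral_scaled (fun y => |φ y|) h0] at this

lemma continuous_mollify {φ : ℝ → ℝ} (hφ : Continuous φ) (hφc : HasCompactSupport φ) {h : ℝ}
    (h0 : 0 < h) (h1 : h ≤ 1) {f : ℝ → ℝ} (hf : Continuous f) : Continuous (mollify φ h f) := by
  obtain ⟨m, hm⟩ := hφc.exists_nat_forall_eq_zero
  have hint : mollify φ h f = fun x => ∫ y in (-(m : ℝ))..m, f (x - y) * (h⁻¹ * φ (y / h)) :=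
    funext fun x => integral_eq_intervalIntegral_of_eq_zero fun y hy => by
      rw [scaled_eq_zero_of_le_one hm h0 h1 y hy, mul_zero]
  rw [hint]
  exact intervalIntegral.continuous_parametric_intervalIntegral_of_continuous' (by fun_prop) _ _

lemma hasDerivAt_mollify {φ : ℝ → ℝ} (hφ : ContDiff ℝ 1 φ) (hφc : HasCompactSupport φ) {h : ℝ}
    (h0 : 0 < h) (h1 : h ≤ 1) {f : ℝ → ℝ} (hf : Continuous f) (x : ℝ) :
    HasDerivAt (mollify φ h f) (h⁻¹ * mollify (deriv φ) h f x) x := by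
  obtain ⟨m, hm⟩ := hφc.exists_nat_forall_eq_zero
  have hKc : HasCompactSupport fun y => h⁻¹ * φ (y / h) :=
    hasCompactSupport_of_eq_zero (scaled_eq_zero_of_le_one hm h0 h1)
  have hK : ContDiff ℝ 1 fun y => h⁻¹ * φ (y / h) := by fun_prop
  have key := hKc.hasDerivAt_convolution_left (μ := volume) (ContinuousLinearMap.mul ℝ ℝ) hK
    hf.locallyIntegrable x
  have hd : deriv (fun y => h⁻¹ * φ (y / h)) = fun y => h⁻¹ * (h⁻¹ * deriv φ (y / h)) := by
    ext y
    have h2 := ((hφ.differentiable one_ne_zero (y / h)).hasDerivAt.comp y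
      ((hasDerivAt_id y).div_const h)).const_mul h⁻¹
    refine h2.deriv.trans ?_
    simp only [one_div]
    ring
  rw [hd] at key
  have e1 : mollify φ h f = convolution (fun y => h⁻¹ * φ (y / h)) f
      (ContinuousLinearMap.mul ℝ ℝ) volume := by
    ext z
    simp only [mollify, convolution, ContinuousLinearMap.mul_apply', mul_comm]
  have e2 : h⁻¹ * mollify (deriv φ) h f x = convolution (fun y => h⁻¹ * (h⁻¹ * deriv φ (y / h))) f
      (ContinuousLinearMap.mul ℝ ℝ) volume x := by
    simp only [mollify, convolution, ContinuousLinearMap.mul_apply']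
    rw [← integral_const_mul]
    congr 1 with y
    ring
  rw [e1, e2]
  exact key

lemma exists_abs_integral_mollify_mul_sub_le {φ g : ℝ → ℝ} (hφ : Continuous φ)
    (hφc : HasCompactSupport φ) (hφ1 : ∫ x, φ x = 1) (hg : ContDiff ℝ 1 g)
    (hgc : HasCompactSupport g) :
    ∃ A, 0 ≤ A ∧ ∀ h, 0 < h → h ≤ 1 → ∀ f : ℝ → ℝ, Continuous f →
      Function.Periodic f (2 * π) →
      |∫ x, (mollify φ h f x - f x) * g x| ≤ A * h * periodNorm f := by
  obtain ⟨m, hm⟩ := hφc.exists_nat_forall_eq_zero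
  obtain ⟨k, hk⟩ := hgc.exists_nat_forall_eq_zero
  obtain ⟨L, hL⟩ := hg.lipschitzWith_of_hasCompactSupport hgc one_ne_zero
  have hgcont := hg.continuous
  refine ⟨L * m * (k + m) * ∫ y, |φ y|, by positivity, fun h h0 h1 f hf hp => ?_⟩
  have hP := periodNorm_nonneg f
  set K : ℝ → ℝ := fun y => h⁻¹ * φ (y / h) with hKdef
  have hKcont : Continuous K := by fun_prop
  have hK0 : ∀ y, (m : ℝ) ≤ |y| → K y = 0 := scaled_eq_zero_of_le_one hm h0 h1
  have hKc : HasCompactSupport K := hasCompactSupport_of_eq_zero hK0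
  have hK1 : ∫ y, K y = 1 := by rw [← hφ1, hKdef, integral_scaled φ h0]
  have hdiff : ∀ x, (mollify φ h f x - f x) * g x = ∫ y, (f (x - y) - f x) * K y * g x := fun x => by
    rw [integral_mul_const]
    congr 1
    simp only [sub_mul]
    rw [integral_sub, integral_const_mul, hK1, mul_one]
    · rfl
    · exact (by fun_prop : Continuous fun y => f (x - y) * K y).integrable_of_hasCompactSupport
        hKc.mul_left
    · exact (hKcont.integrable_of_hasCompactSupport hKc).const_mul _
  simp only [hdiff]
  rw [integral_integral_swap_of_hasCompactSupport]
  rotate_left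
  · fun_prop
  · refine HasCompactSupport.intro
      ((isCompact_Icc (a := -(k : ℝ)) (b := k)).prod (isCompact_Icc (a := -(m : ℝ)) (b := m)))
      fun p hp => ?_
    simp only [Function.uncurry]
    by_cases h2 : (k : ℝ) ≤ |p.1|
    · rw [hk _ h2, mul_zero]
    · rw [hK0, mul_zero, zero_mul]
      by_contra h3
      exact hp ⟨abs_le.1 (not_le.1 h2).le, abs_le.1 (not_le.1 h3).le⟩
  have inner : ∀ y, ∫ x, (f (x - y) - f x) * K y * g x = K y * ∫ x, f x * (g (x + y) - g x) := by
    intro y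
    have i1 : Integrable fun x => f x * g (x + y) :=
      (by fun_prop : Continuous fun x => f x * g (x + y)).integrable_of_hasCompactSupport
        (HasCompactSupport.mul_left (hgc.comp_homeomorph (Homeomorph.addRight y)))
    have i2 : Integrable fun x => f x * g x :=
      (by fun_prop : Continuous fun x => f x * g x).integrable_of_hasCompactSupport hgc.mul_left
    have i3 : Integrable fun x => f (x - y) * g x :=
      (by fun_prop : Continuous fun x => f (x - y) * g x).integrable_of_hasCompactSupport
        hgc.mul_left
    have e1 : ∫ x, f x * g (x + y) = ∫ x, f (x - y) * g x := by
      rw [← integral_sub_right_eq_self (fun x => f x * g (x + y)) y]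
      simp only [sub_add_cancel]
    simp only [mul_sub]
    rw [integral_sub i1 i2, e1, ← integral_sub i3 i2, ← integral_const_mul]
    congr 1 with x
    ring
  simp only [inner]
  have bound : ∀ y, ‖K y * ∫ x, f x * (g (x + y) - g x)‖
      ≤ |K y| * (L * (h * m) * (k + m) * periodNorm f) := fun y => by
    rw [norm_mul, norm_eq_abs]
    by_cases hy : h * m ≤ |y|
    · rw [show K y = 0 from scaled_eq_zero hm h0 hy]; simp
    gcongr
    have hy' : |y| ≤ m := (not_le.1 hy).le.trans (mul_le_of_le_one_left (by positivity) h1)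
    have := abs_integral_le_mul_periodNorm (F := fun x => f x * (g (x + y) - g x)) hf hp
      (c := L * (h * m)) (by positivity) (m := k + m) (fun x hx => ?_) (fun x => ?_)
    · push_cast at this; exact this
    · push_cast at hx
      have h3 := abs_sub_abs_le_abs_sub x (-y)
      rw [abs_neg, sub_neg_eq_add] at h3
      rw [hk x (by linarith [Nat.cast_nonneg (α := ℝ) m]), hk (x + y) (by linarith)]
      simp
    · rw [abs_mul, mul_comm]
      gcongr
      have := hL.dist_le_mul (x + y) x
      rw [dist_eq, dist_eq, add_sub_cancel_left] at this
      exact this.trans (by gcongr; exact (not_le.1 hy).le)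
  have hKi : Integrable fun y => |K y| :=
    hKcont.abs.integrable_of_hasCompactSupport hKc.norm
  refine (norm_integral_le_of_norm_le (hKi.mul_const _) (Eventually.of_forall bound)).trans_eq ?_
  rw [integral_mul_const]
  have e : ∫ y, |K y| = ∫ y, |φ y| := by
    simp only [hKdef, abs_mul, abs_of_pos (inv_pos.2 h0)]
    exact integral_scaled (fun y => |φ y|) h0
  rw [e]
  ring

lemma exists_abs_integral_deriv_mollify_le {φ ψ : ℝ → ℝ} (hφ : ContDiff ℝ 1 φ)
    (hφc : HasCompactSupport φ) (hφ1 : ∫ x, φ x = 1) (hψ : ContDiff ℝ 2 ψ)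
    (hψc : HasCompactSupport ψ) :
    ∃ A, 0 ≤ A ∧ ∀ h, 0 < h → h ≤ 1 → ∀ f : ℝ → ℝ, Continuous f →
      Function.Periodic f (2 * π) →
      |∫ x, (-deriv (mollify φ h f) x * ψ x - f x * deriv ψ x)| ≤ A * h * periodNorm f := by
  have hψ' : ContDiff ℝ 1 (deriv ψ) := (contDiff_succ_iff_deriv.1 hψ).2.2
  obtain ⟨A, hA, H⟩ := exists_abs_integral_mollify_mul_sub_le hφ.continuous hφc hφ1 hψ'
    hψc.deriv
  refine ⟨A, hA, fun h h0 h1 f hf hp => ?_⟩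
  have hd := hasDerivAt_mollify hφ hφc h0 h1 hf
  have hc := continuous_mollify hφ.continuous hφc h0 h1 hf
  have hc' := continuous_mollify (hφ.continuous_deriv le_rfl) hφc.deriv h0 h1 hf
  have hψ'c := hψ'.continuous
  have hψcont := hψ.continuous
  have hder : deriv (mollify φ h f) = fun x => h⁻¹ * mollify (deriv φ) h f x :=
    funext fun x => (hd x).deriv
  have i1 : Integrable fun x => mollify φ h f x * deriv ψ x :=
    (hc.mul hψ'c).integrable_of_hasCompactSupport hψc.deriv.mul_left
  have i2 : Integrable fun x => h⁻¹ * mollify (deriv φ) h f x * ψ x :=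
    ((hc'.const_mul _).mul hψcont).integrable_of_hasCompactSupport hψc.mul_left
  have i3 : Integrable fun x => mollify φ h f x * ψ x :=
    (hc.mul hψcont).integrable_of_hasCompactSupport hψc.mul_left
  have i4 : Integrable fun x => f x * deriv ψ x :=
    (hf.mul hψ'c).integrable_of_hasCompactSupport hψc.deriv.mul_left
  have parts := integral_mul_deriv_eq_deriv_mul_of_integrable (u := mollify φ h f) (v := ψ)
    (fun x _ => hd x) (fun x _ => (hψ.differentiable two_ne_zero x).hasDerivAt) i1 i2 i3
  convert H h h0 h1 f hf hp using 2
  simp only [hder, sub_mul, neg_mul]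
  have i2' : Integrable fun x => -(h⁻¹ * mollify (deriv φ) h f x * ψ x) := i2.neg
  rw [integral_sub i2' i4, integral_neg, ← parts, ← integral_sub i1 i4]

lemma abs_sub_sub_mul_deriv_le {ψ : ℝ → ℝ} (hψ : Differentiable ℝ ψ) {L : NNReal}
    (hL : LipschitzWith L (deriv ψ)) (x s : ℝ) :
    |ψ (x + s) - ψ x - s * deriv ψ x| ≤ L * s ^ 2 := by
  have key := (convex_uIcc x (x + s)).norm_image_sub_le_of_norm_hasDerivWithin_le
    (f := fun y => ψ y - y * deriv ψ x) (f' := fun y => deriv ψ y - 1 * deriv ψ x)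
    (C := L * |s|) (x := x) (y := x + s)
    (fun y _ => ((hψ y).hasDerivAt.sub ((hasDerivAt_id y).mul_const _)).hasDerivWithinAt)
    (fun y hy => ?_) left_mem_uIcc right_mem_uIcc
  · rw [add_sub_cancel_left, norm_eq_abs, norm_eq_abs] at key
    rw [← sq_abs s]
    refine (le_of_eq ?_).trans (key.trans_eq (by ring))
    congr 1
    ring
  · rw [one_mul, ← dist_eq_norm]
    refine (hL.dist_le_mul y x).trans ?_
    gcongr
    rw [dist_eq]
    simpa using abs_sub_left_of_mem_uIcc hy

lemma exists_abs_integral_upwind_mul_sub_le {ψ : ℝ → ℝ} (hψ : ContDiff ℝ 2 ψ)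
    (hψc : HasCompactSupport ψ) :
    ∃ A, 0 ≤ A ∧ ∀ ε, 0 < ε → ε ≤ 1 → ∀ u f : ℝ → ℝ, Continuous u → Continuous f →
      Function.Periodic f (2 * π) → ∀ M, (∀ x, |u x| ≤ M) →
      |∫ x, (upwind ε u f x * ψ x - u x * f x * deriv ψ x)| ≤ A * M * ε * periodNorm f := by
  have hψ' : ContDiff ℝ 1 (deriv ψ) := (contDiff_succ_iff_deriv.1 hψ).2.2
  obtain ⟨L, hL⟩ := hψ'.lipschitzWith_of_hasCompactSupport hψc.deriv one_ne_zero
  obtain ⟨m, hm⟩ := hψc.exists_nat_forall_eq_zero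
  obtain ⟨k, hk⟩ := hψc.deriv.exists_nat_forall_eq_zero
  have hd := hψ.differentiable two_ne_zero
  have hψ'c := hψ'.continuous
  have hψcont := hψ.continuous
  refine ⟨L * (m + k + 1), by positivity, fun ε h0 h1 u f hu hf hp M hM => ?_⟩
  have hM0 : 0 ≤ M := (abs_nonneg _).trans (hM 0)
  have hp1 : HasCompactSupport fun x => ψ (x + ε) :=
    hψc.comp_homeomorph (Homeomorph.addRight ε)
  have hp2 : HasCompactSupport fun x => ψ (x - ε) :=
    hψc.comp_homeomorph (Homeomorph.subRight ε)
  have i1 : Integrable fun x => f (x - ε) * max (u (x - ε)) 0 * ψ x :=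
    (by fun_prop : Continuous fun x => f (x - ε) * max (u (x - ε)) 0 * ψ x).integrable_of_hasCompactSupport
      hψc.mul_left
  have i2 : Integrable fun x => f x * |u x| * ψ x :=
    (by fun_prop : Continuous fun x => f x * |u x| * ψ x).integrable_of_hasCompactSupport
      hψc.mul_left
  have i3 : Integrable fun x => f (x + ε) * max (-(u (x + ε))) 0 * ψ x :=
    (by fun_prop : Continuous fun x => f (x + ε) * max (-(u (x + ε))) 0 * ψ x).integrable_of_hasCompactSupport
      hψc.mul_left
  have i4 : Integrable fun x => u x * f x * deriv ψ x :=
    (by fun_prop : Continuous fun x => u x * f x * deriv ψ x).integrable_of_hasCompactSupport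
      hψc.deriv.mul_left
  have j1 : Integrable fun x => f x * max (u x) 0 * ψ (x + ε) :=
    (by fun_prop : Continuous fun x => f x * max (u x) 0 * ψ (x + ε)).integrable_of_hasCompactSupport
      hp1.mul_left
  have j3 : Integrable fun x => f x * max (-(u x)) 0 * ψ (x - ε) :=
    (by fun_prop : Continuous fun x => f x * max (-(u x)) 0 * ψ (x - ε)).integrable_of_hasCompactSupport
      hp2.mul_left
  have e1 : ∫ x, f (x - ε) * max (u (x - ε)) 0 * ψ x = ∫ x, f x * max (u x) 0 * ψ (x + ε) := by
    rw [← integral_sub_right_eq_self (fun x => f x * max (u x) 0 * ψ (x + ε)) ε]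
    simp only [sub_add_cancel]
  have e3 : ∫ x, f (x + ε) * max (-(u (x + ε))) 0 * ψ x
      = ∫ x, f x * max (-(u x)) 0 * ψ (x - ε) := by
    rw [← integral_add_right_eq_self (fun x => f x * max (-(u x)) 0 * ψ (x - ε)) ε]
    simp only [add_sub_cancel_right]
  have key : ∫ x, (upwind ε u f x * ψ x - u x * f x * deriv ψ x)
      = ∫ x, (ε⁻¹ * (f x * max (u x) 0 * ψ (x + ε) - f x * |u x| * ψ x
        + f x * max (-(u x)) 0 * ψ (x - ε)) - u x * f x * deriv ψ x) := by
    have lhs : ∀ x, upwind ε u f x * ψ x = ε⁻¹ * (f (x - ε) * max (u (x - ε)) 0 * ψ x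
        - f x * |u x| * ψ x + f (x + ε) * max (-(u (x + ε))) 0 * ψ x) := fun x => by
      rw [upwind]; ring
    have s1 : Integrable fun x => f (x - ε) * max (u (x - ε)) 0 * ψ x - f x * |u x| * ψ x :=
      i1.sub i2
    have s2 : Integrable fun x => f x * max (u x) 0 * ψ (x + ε) - f x * |u x| * ψ x := j1.sub i2
    have s3 : Integrable fun x => ε⁻¹ * (f (x - ε) * max (u (x - ε)) 0 * ψ x
        - f x * |u x| * ψ x + f (x + ε) * max (-(u (x + ε))) 0 * ψ x) := (s1.add i3).const_mul _
    have s4 : Integrable fun x => ε⁻¹ * (f x * max (u x) 0 * ψ (x + ε)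
        - f x * |u x| * ψ x + f x * max (-(u x)) 0 * ψ (x - ε)) := (s2.add j3).const_mul _
    simp only [lhs]
    rw [integral_sub s3 i4, integral_sub s4 i4, integral_const_mul, integral_const_mul,
      integral_add s1 i3, integral_add s2 j3, integral_sub i1 i2, integral_sub j1 i2, e1, e3]
  rw [key]
  have := abs_integral_le_mul_periodNorm (F := fun x =>
      ε⁻¹ * (f x * max (u x) 0 * ψ (x + ε) - f x * |u x| * ψ x
        + f x * max (-(u x)) 0 * ψ (x - ε)) - u x * f x * deriv ψ x) hf hp
      (c := M * L * ε) (by positivity) (m := m + k + 1) (fun x hx => ?_) (fun x => ?_)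
  · push_cast at this
    exact this.trans_eq (by ring)
  · push_cast at hx
    have hm0 : (0 : ℝ) ≤ m := by positivity
    have hk0 : (0 : ℝ) ≤ k := by positivity
    have h3 := abs_sub_abs_le_abs_sub x (-ε)
    have h4 := abs_sub_abs_le_abs_sub x ε
    rw [abs_neg, sub_neg_eq_add, abs_of_pos h0] at h3
    rw [abs_of_pos h0] at h4
    rw [hm x (by linarith), hm (x + ε) (by linarith), hm (x - ε) (by linarith),
      hk x (by linarith)]
    simp
  · have t1 := abs_sub_sub_mul_deriv_le hd hL x ε
    have t2 := abs_sub_sub_mul_deriv_le hd hL x (-ε)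
    rw [← sub_eq_add_neg] at t2
    have eabs : |u x| = max (u x) 0 + max (-(u x)) 0 := by
      rcases le_total 0 (u x) with h | h
      · rw [abs_of_nonneg h, max_eq_left h, max_eq_right (by linarith), add_zero]
      · rw [abs_of_nonpos h, max_eq_right h, max_eq_left (by linarith), zero_add]
    have esub : u x = max (u x) 0 - max (-(u x)) 0 := by
      rcases le_total 0 (u x) with h | h
      · rw [max_eq_left h, max_eq_right (by linarith), sub_zero]
      · rw [max_eq_right h, max_eq_left (by linarith)]; ring
    have hMx := hM x
    have ha : 0 ≤ max (u x) 0 := le_max_right _ _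
    have hb : 0 ≤ max (-(u x)) 0 := le_max_right _ _
    rw [eabs] at hMx
    have expand : ε⁻¹ * (f x * max (u x) 0 * ψ (x + ε) - f x * |u x| * ψ x
        + f x * max (-(u x)) 0 * ψ (x - ε)) - u x * f x * deriv ψ x
        = ε⁻¹ * (max (u x) 0 * (ψ (x + ε) - ψ x - ε * deriv ψ x)
          + max (-(u x)) 0 * (ψ (x - ε) - ψ x - -ε * deriv ψ x)) * f x := by
      rw [eabs]
      field_simp
      linear_combination (-f x * ε * deriv ψ x) * esub
    rw [expand, abs_mul]
    gcongr
    rw [abs_mul, abs_of_pos (inv_pos.2 h0), inv_mul_le_iff₀ h0]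
    refine (abs_add_le _ _).trans ?_
    rw [abs_mul, abs_mul, abs_of_nonneg ha, abs_of_nonneg hb]
    calc _ ≤ max (u x) 0 * (L * ε ^ 2) + max (-(u x)) 0 * (L * (-ε) ^ 2) := by gcongr
      _ = (max (u x) 0 + max (-(u x)) 0) * (L * ε ^ 2) := by ring
      _ ≤ M * (L * ε ^ 2) := by gcongr
      _ = ε * (M * L * ε) := by ring

lemma continuous_upwind {ε : ℝ} {u f : ℝ → ℝ} (hu : Continuous u) (hf : Continuous f) :
    Continuous (upwind ε u f) := by
  unfold upwind
  fun_prop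

lemma periodNorm_mul_le {a b : ℝ → ℝ} (ha : Continuous a) (hb : Continuous b) {A : ℝ}
    (hA : ∀ x, |a x| ≤ A) : periodNorm (fun x => a x * b x) ≤ A * periodNorm b := by
  refine (periodNorm_le_of_abs_le (by fun_prop) (hb.abs.const_mul A) fun x => ?_).trans_eq
    (intervalIntegral.integral_const_mul _ _)
  rw [abs_mul]
  gcongr
  exact hA x

lemma periodNorm_add_upwind_le {ε M s : ℝ} (hε : 0 < ε) (hs : 0 ≤ s) (hsM : s * M ≤ ε)
    {u f : ℝ → ℝ} (hu : Continuous u) (hup : Function.Periodic u (2 * π)) (huM : ∀ x, |u x| ≤ M)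
    (hf : Continuous f) (hfp : Function.Periodic f (2 * π)) :
    periodNorm (fun x => f x + s * upwind ε u f x) ≤ periodNorm f := by
  obtain ⟨r, hr⟩ : ∃ r, r = s * ε⁻¹ := ⟨_, rfl⟩
  have hr0 : 0 ≤ r := by rw [hr]; positivity
  have hrM : r * M ≤ 1 := by
    rw [hr, mul_right_comm, ← div_eq_mul_inv]
    exact (div_le_one hε).2 hsM
  have hcu := continuous_upwind (ε := ε) hu hf
  refine (periodNorm_le_of_abs_le (g := fun x => |f x| * (1 - r * |u x|)
    + r * (|f (x - ε)| * max (u (x - ε)) 0) + r * (|f (x + ε)| * max (-(u (x + ε))) 0))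
    (by fun_prop) (by fun_prop) fun x => ?_).trans_eq ?_
  · have h1 : 0 ≤ 1 - r * |u x| := by nlinarith [huM x]
    have e : f x + s * upwind ε u f x = f x * (1 - r * |u x|)
        + r * (f (x - ε) * max (u (x - ε)) 0) + r * (f (x + ε) * max (-(u (x + ε))) 0) := by
      rw [upwind, hr]; ring
    rw [e]
    refine (abs_add_le _ _).trans (add_le_add ((abs_add_le _ _).trans (add_le_add ?_ ?_)) ?_)
    · rw [abs_mul, abs_of_nonneg h1]
    · rw [abs_mul, abs_mul, abs_of_nonneg hr0, abs_of_nonneg (le_max_right (u (x - ε)) 0)]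
    · rw [abs_mul, abs_mul, abs_of_nonneg hr0, abs_of_nonneg (le_max_right (-u (x + ε)) 0)]
  · have p1 : Function.Periodic (fun x => |f x| * max (u x) 0) (2 * π) := fun x => by
      simp only [hfp x, hup x]
    have p2 : Function.Periodic (fun x => |f x| * max (-(u x)) 0) (2 * π) := fun x => by
      simp only [hfp x, hup x]
    have i1 : Continuous fun x => |f x| * (1 - r * |u x|) := by fun_prop
    have i2 : Continuous fun x => r * (|f (x - ε)| * max (u (x - ε)) 0) := by fun_prop
    have i3 : Continuous fun x => r * (|f (x + ε)| * max (-(u (x + ε))) 0) := by fun_prop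
    have i4 : Continuous fun x => r * (|f x| * max (u x) 0) := by fun_prop
    have i5 : Continuous fun x => r * (|f x| * max (-(u x)) 0) := by fun_prop
    have i6 : Continuous fun x => |f x| * (1 - r * |u x|)
        + r * (|f (x - ε)| * max (u (x - ε)) 0) := i1.add i2
    have i7 : Continuous fun x => |f x| * (1 - r * |u x|) + r * (|f x| * max (u x) 0) := i1.add i4
    rw [intervalIntegral.integral_add (i6.intervalIntegrable _ _)
        (i3.intervalIntegrable _ _), intervalIntegral.integral_add (i1.intervalIntegrable _ _)
        (i2.intervalIntegrable _ _), intervalIntegral.integral_const_mul,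
      intervalIntegral.integral_const_mul, p1.integral_comp_sub_eq ε, p2.integral_comp_add_eq ε,
      ← intervalIntegral.integral_const_mul, ← intervalIntegral.integral_const_mul,
      ← intervalIntegral.integral_add (i1.intervalIntegrable _ _) (i4.intervalIntegrable _ _),
      ← intervalIntegral.integral_add (i7.intervalIntegrable _ _)
        (i5.intervalIntegrable _ _), periodNorm]
    congr 1 with x
    rcases le_total 0 (u x) with h | h
    · rw [abs_of_nonneg h, max_eq_left h, max_eq_right (by linarith)]; ring
    · rw [abs_of_nonpos h, max_eq_right h, max_eq_left (by linarith)]; ring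

lemma periodNorm_le_of_hasDerivWithinAt {ε M δ G : ℝ} (hε : 0 < ε) (hM : 0 < M)
    {q g : ℝ → ℝ → ℝ} {Y Y' : ℝ → BoundedContinuousFunction ℝ ℝ}
    (hY : ∀ t ∈ Ici (0:ℝ), HasDerivWithinAt Y (Y' t) (Ici 0) t)
    (hYp : ∀ t ∈ Ici (0:ℝ), Function.Periodic (Y t) (2 * π))
    (hq : ∀ t ∈ Ici (0:ℝ), Continuous (q t))
    (hqp : ∀ t ∈ Ici (0:ℝ), Function.Periodic (q t) (2 * π))
    (hqM : ∀ t ∈ Ici (0:ℝ), ∀ x, |q t x| ≤ M)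
    (heq : ∀ t ∈ Ici (0:ℝ), ∀ x, Y' t x = upwind ε (q t) (Y t) x + g t x)
    (hG : ∀ t ∈ Icc 0 δ, periodNorm (g t) ≤ G) :
    ∀ t ∈ Icc 0 δ, periodNorm (Y t) ≤ periodNorm (Y 0) + G * t := by
  have hN : Continuous fun F : BoundedContinuousFunction ℝ ℝ => periodNorm F :=
    intervalIntegral.continuous_parametric_intervalIntegral_of_continuous'
      (f := fun (F : BoundedContinuousFunction ℝ ℝ) x => |F x|) (by
        simp only [Function.uncurry_def]; fun_prop) _ _
  have hYc : ContinuousOn (fun t => periodNorm (Y t)) (Icc 0 δ) :=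
    hN.comp_continuousOn fun t ht =>
      ((hY t ht.1).continuousWithinAt).mono Icc_subset_Ici_self
  refine image_le_of_liminf_slope_right_le_deriv_boundary hYc (by simp) (by fun_prop)
    (B' := fun _ => G) (fun t _ => ?_) fun t ht r hr => ?_
  · simpa using (((hasDerivAt_id t).const_mul G).const_add (periodNorm (Y 0))).hasDerivWithinAt
  have ht0 : t ∈ Ici (0:ℝ) := ht.1
  refine Eventually.frequently ?_
  obtain ⟨c, hc, hcr⟩ : ∃ c > 0, G + c * (2 * π) < r := by
    refine ⟨(r - G) / (4 * π), div_pos (by linarith) (by positivity), ?_⟩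
    have : (r - G) / (4 * π) * (2 * π) = (r - G) / 2 := by field_simp; norm_num
    linarith
  have hlo := (hasDerivWithinAt_iff_isLittleO.1 (hY t ht0)).def hc
  have hsub : 𝓝[>] t ≤ 𝓝[Ici 0] t :=
    nhdsWithin_mono t fun s hs => (mem_Ici.1 ht0).trans (le_of_lt hs)
  have hsmall : ∀ᶠ s in 𝓝[>] t, s < t + ε / M :=
    nhdsWithin_le_nhds (eventually_lt_nhds (by linarith [div_pos hε hM]))
  filter_upwards [hsub hlo, hsmall, self_mem_nhdsWithin] with s hs hs' hts
  have hst : 0 < s - t := sub_pos.2 hts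
  have hstM : (s - t) * M ≤ ε := by
    rw [← le_div_iff₀ hM]; linarith
  have hg : Continuous (g t) := by
    have : g t = fun x => Y' t x - upwind ε (q t) (Y t) x := by
      ext x; rw [heq t ht0 x]; ring
    rw [this]
    exact (Y' t).continuous.sub (continuous_upwind (hq t ht0) (Y t).continuous)
  have hcu := continuous_upwind (ε := ε) (hq t ht0) (Y t).continuous
  have c1 : Continuous fun x => |Y t x + (s - t) * upwind ε (q t) (Y t) x| := by fun_prop
  have c2 : Continuous fun x => (s - t) * |g t x| := by fun_prop
  have c3 : Continuous fun x => |Y t x + (s - t) * upwind ε (q t) (Y t) x| + (s - t) * |g t x| :=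
    c1.add c2
  have step : periodNorm (Y s) ≤ periodNorm (Y t) + (s - t) * G + c * (s - t) * (2 * π) := by
    refine (periodNorm_le_of_abs_le (g := fun x => |Y t x + (s - t) * upwind ε (q t) (Y t) x|
      + (s - t) * |g t x| + c * (s - t)) (Y s).continuous (by fun_prop) fun x => ?_).trans ?_
    · have h1 := (BoundedContinuousFunction.norm_coe_le_norm
        (Y s - Y t - (s - t) • Y' t) x).trans hs
      simp only [BoundedContinuousFunction.coe_sub, BoundedContinuousFunction.coe_smul,
        Pi.sub_apply, smul_eq_mul, norm_eq_abs, heq t ht0, abs_of_pos hst] at h1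
      have e : Y s x = (Y t x + (s - t) * upwind ε (q t) (Y t) x) + (s - t) * g t x
          + (Y s x - Y t x - (s - t) * (upwind ε (q t) (Y t) x + g t x)) := by ring
      rw [e]
      refine (abs_add_le _ _).trans (add_le_add ((abs_add_le _ _).trans
        (add_le_add le_rfl ?_)) h1)
      rw [abs_mul, abs_of_pos hst]
    · rw [intervalIntegral.integral_add (c3.intervalIntegrable _ _)
        intervalIntegrable_const, intervalIntegral.integral_add (c1.intervalIntegrable _ _)
        (c2.intervalIntegrable _ _), intervalIntegral.integral_const_mul,
        intervalIntegral.integral_const, smul_eq_mul]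
      have h2 := periodNorm_add_upwind_le hε hst.le hstM (hq t ht0) (hqp t ht0) (hqM t ht0)
        (Y t).continuous (hYp t ht0)
      have h3 : (s - t) * periodNorm (g t) ≤ (s - t) * G := by
        gcongr
        exact hG t (Ico_subset_Icc_self ht)
      unfold periodNorm at h2 h3 ⊢
      linarith
  rw [slope_def_field, div_lt_iff₀ hst]
  nlinarith

/-- Theorem 2: provided `0 < β < α`, `γ > (n+2)α` and `2γ + (n+2)α < 1`, the family
`(u_ε, v_ε, w_ε, Z_ε)` is a weak asymptotic method for the Panov–Shelkovich system
augmented by `∂ₜZ + ∂ₓ(uZ) + ∂ₓ(vw) = 0`: for every test function `ψ` and every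
`δ > 0`, `sup_{t∈[0,δ]} |∫ (∂ₜZ_ε ψ − u_ε Z_ε ψ' − v_ε w_ε ψ') dx| → 0` as `ε → 0`. -/
theorem stmt9 (n : ℕ) (hn : 1 ≤ n) (α β γ : ℝ)
    (hα : 0 < α) (hβ : 0 < β) (hγ : 0 < γ) (hβα : β < α)
    (hγα : ((n : ℝ) + 2) * α < γ) (hsmall : 2 * γ + ((n : ℝ) + 2) * α < 1)
    (φ : ℝ → ℝ) (hφ : ContDiff ℝ (⊤ : ℕ∞) φ) (hφc : HasCompactSupport φ) (hφ1 : ∫ x, φ x = 1)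
    (u : ℝ → ℝ → ℝ → ℝ) -- `u ε x t`
    (hu_cont : ∀ ε ∈ Ioo (0:ℝ) 1,
      ContinuousOn (fun p : ℝ × ℝ => u ε p.1 p.2) (univ ×ˢ Ici 0))
    (hu_curve : ∀ ε ∈ Ioo (0:ℝ) 1, ∃ U : ℝ → BoundedContinuousFunction ℝ ℝ,
      ContinuousOn U (Ici 0) ∧ ∀ t ∈ Ici (0:ℝ), ∀ x : ℝ, U t x = u ε x t)
    (hu_per : ∀ ε ∈ Ioo (0:ℝ) 1, ∀ x : ℝ, ∀ t ∈ Ici (0:ℝ), u ε (x + 2*π) t = u ε x t)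
    (M₁ : ℝ) (hM₁ : 0 < M₁)
    (hu_bdd : ∀ ε ∈ Ioo (0:ℝ) 1, ∀ x : ℝ, ∀ t ∈ Ici (0:ℝ), |u ε x t| ≤ M₁)
    (hu_diff : ∀ ε ∈ Ioo (0:ℝ) 1, ∀ t ∈ Ici (0:ℝ), Differentiable ℝ (fun y => u ε y t))
    (hu_dx : ∀ δ > (0:ℝ), ∃ Cδ > (0:ℝ), ∀ ε ∈ Ioo (0:ℝ) 1, ∀ x : ℝ, ∀ t ∈ Icc (0:ℝ) δ,
      |deriv (fun y => u ε y t) x| ≤ Cδ / ε ^ β)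
    (v₀ : ℝ → ℝ → ℝ) -- `v₀ ε x`
    (hv₀c : ∀ ε ∈ Ioo (0:ℝ) 1, Continuous (v₀ ε))
    (hv₀p : ∀ ε ∈ Ioo (0:ℝ) 1, ∀ x : ℝ, v₀ ε (x + 2*π) = v₀ ε x)
    (C₀ : ℝ) (hv₀i : ∀ ε ∈ Ioo (0:ℝ) 1, (∫ x in (-π)..π, |v₀ ε x|) ≤ C₀)
    (X : ℝ → ℝ → BoundedContinuousFunction ℝ ℝ) -- `X ε t`
    (hX : ∀ ε ∈ Ioo (0:ℝ) 1, IsDiscreteTransportSol ε (u ε) (X ε))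
    (hX0 : ∀ ε ∈ Ioo (0:ℝ) 1, ∀ x : ℝ, X ε 0 x = v₀ ε x)
    (hXper : ∀ ε ∈ Ioo (0:ℝ) 1, ∀ t ∈ Ici (0:ℝ), ∀ x : ℝ, X ε t (x + 2*π) = X ε t x)
    (v : ℝ → ℝ → ℝ → ℝ) -- `v ε x t`, the mollified family
    (hv : ∀ ε ∈ Ioo (0:ℝ) 1, ∀ x t : ℝ,
      v ε x t = ∫ y, X ε t (x - y) * ((ε ^ α)⁻¹ * φ (y / ε ^ α)))
    (w₀ : ℝ → ℝ → ℝ) -- `w₀ ε x`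
    (hw₀c : ∀ ε ∈ Ioo (0:ℝ) 1, Continuous (w₀ ε))
    (hw₀p : ∀ ε ∈ Ioo (0:ℝ) 1, ∀ x : ℝ, w₀ ε (x + 2*π) = w₀ ε x)
    (C₀' : ℝ) (hw₀i : ∀ ε ∈ Ioo (0:ℝ) 1, (∫ x in (-π)..π, |w₀ ε x|) ≤ C₀')
    (w : ℝ → ℝ → BoundedContinuousFunction ℝ ℝ) -- `w ε t`
    (hw0 : ∀ ε ∈ Ioo (0:ℝ) 1, ∀ x : ℝ, w ε 0 x = w₀ ε x)
    (hwper : ∀ ε ∈ Ioo (0:ℝ) 1, ∀ t ∈ Ici (0:ℝ), ∀ x : ℝ, w ε t (x + 2*π) = w ε t x)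
    (hw : ∀ ε ∈ Ioo (0:ℝ) 1, ∃ w' : ℝ → BoundedContinuousFunction ℝ ℝ,
      ContinuousOn w' (Ici 0) ∧
      (∀ t ∈ Ici (0:ℝ), HasDerivWithinAt (w ε) (w' t) (Ici 0) t) ∧
      (∀ t ∈ Ici (0:ℝ), ∀ x : ℝ,
        w' t x = ε⁻¹ * (w ε t (x - ε) * max (u ε (x - ε) t) 0
          - w ε t x * |u ε x t| + w ε t (x + ε) * max (-(u ε (x + ε) t)) 0)
          - (n : ℝ) * (v ε x t) ^ (n - 1) * deriv (fun z => v ε z t) x))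
    (Z₀ : ℝ → ℝ → ℝ) -- `Z₀ ε x`
    (hZ₀c : ∀ ε ∈ Ioo (0:ℝ) 1, Continuous (Z₀ ε))
    (hZ₀p : ∀ ε ∈ Ioo (0:ℝ) 1, ∀ x : ℝ, Z₀ ε (x + 2*π) = Z₀ ε x)
    (C₀'' : ℝ) (hZ₀i : ∀ ε ∈ Ioo (0:ℝ) 1, (∫ x in (-π)..π, |Z₀ ε x|) ≤ C₀'')
    (Z : ℝ → ℝ → BoundedContinuousFunction ℝ ℝ) -- `Z ε t`
    (hZ0 : ∀ ε ∈ Ioo (0:ℝ) 1, ∀ x : ℝ, Z ε 0 x = Z₀ ε x)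
    (hZper : ∀ ε ∈ Ioo (0:ℝ) 1, ∀ t ∈ Ici (0:ℝ), ∀ x : ℝ, Z ε t (x + 2*π) = Z ε t x)
    (hZ : ∀ ε ∈ Ioo (0:ℝ) 1, ∃ Z' : ℝ → BoundedContinuousFunction ℝ ℝ,
      ContinuousOn Z' (Ici 0) ∧
      (∀ t ∈ Ici (0:ℝ), HasDerivWithinAt (Z ε) (Z' t) (Ici 0) t) ∧
      (∀ t ∈ Ici (0:ℝ), ∀ x : ℝ,
        Z' t x = ε⁻¹ * (Z ε t (x - ε) * max (u ε (x - ε) t) 0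
          - Z ε t x * |u ε x t| + Z ε t (x + ε) * max (-(u ε (x + ε) t)) 0)
          - deriv (fun z => ∫ y, (v ε (z - y) t * w ε t (z - y))
              * ((ε ^ γ)⁻¹ * φ (y / ε ^ γ))) x))
    (ψ : ℝ → ℝ) (hψ : ContDiff ℝ (⊤ : ℕ∞) ψ) (hψc : HasCompactSupport ψ)
    (δ : ℝ) (hδ : 0 < δ) :
    ∀ η > (0:ℝ), ∃ ε₀ > (0:ℝ), ∀ ε ∈ Ioo (0:ℝ) 1, ε < ε₀ → ∀ t ∈ Icc (0:ℝ) δ,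
      |∫ x, (derivWithin (fun s => Z ε s x) (Ici 0) t * ψ x
        - u ε x t * Z ε t x * deriv ψ x - v ε x t * w ε t x * deriv ψ x)| < η := by
  have hφ1' : ContDiff ℝ 1 φ := hφ.of_le (by exact_mod_cast le_top)
  have hψ2 : ContDiff ℝ 2 ψ := hψ.of_le (WithTop.coe_le_coe.2 (le_top : (2 : ℕ∞) ≤ ⊤))
  have hφ' : Continuous (deriv φ) := hφ1'.continuous_deriv le_rfl
  obtain ⟨A, hA, hAle⟩ := exists_abs_mollify_le hφ1'.continuous hφc
  obtain ⟨B, hB, hBle⟩ := exists_abs_integral_deriv_mollify_le hφ1' hφc hφ1 hψ2 hψc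
  obtain ⟨D, hD, hDle⟩ := exists_abs_integral_upwind_mul_sub_le hψ2 hψc
  obtain ⟨I, hI⟩ : ∃ I, I = ∫ y, |deriv φ y| := ⟨_, rfl⟩
  have hI0 : 0 ≤ I := hI ▸ integral_nonneg fun _ => abs_nonneg _
  have hhalf : (1 / 2 : ℝ) ∈ Ioo (0:ℝ) 1 := by norm_num
  have hC₀ : 0 ≤ C₀ := (periodNorm_nonneg (v₀ (1 / 2))).trans (hv₀i _ hhalf)
  have hC₀' : 0 ≤ C₀' := (periodNorm_nonneg (w₀ (1 / 2))).trans (hw₀i _ hhalf)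
  have hC₀'' : 0 ≤ C₀'' := (periodNorm_nonneg (Z₀ (1 / 2))).trans (hZ₀i _ hhalf)
  set E : ℝ := n * (A * C₀) ^ (n - 1) * (I * C₀) with hE
  have hE0 : 0 ≤ E := by positivity
  set F : ℝ := A * C₀ * (C₀' + E * δ) with hF
  have hF0 : 0 ≤ F := by positivity
  have key : ∀ ε ∈ Ioo (0:ℝ) 1, ∀ t ∈ Icc (0:ℝ) δ,
      |∫ x, (derivWithin (fun s => Z ε s x) (Ici 0) t * ψ x
        - u ε x t * Z ε t x * deriv ψ x - v ε x t * w ε t x * deriv ψ x)|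
      ≤ D * M₁ * (C₀'' + I * F * δ) * (ε * (ε ^ γ)⁻¹ * (ε ^ α)⁻¹ ^ (n + 1))
        + B * F * (ε ^ γ * (ε ^ α)⁻¹ ^ (n + 1)) := by
    intro ε hε
    have hε0 := hε.1
    have hα0 : 0 < ε ^ α := rpow_pos_of_pos hε0 _
    have hα1 : ε ^ α ≤ 1 := rpow_le_one hε0.le hε.2.le hα.le
    have hγ0 : 0 < ε ^ γ := rpow_pos_of_pos hε0 _
    have hγ1 : ε ^ γ ≤ 1 := rpow_le_one hε0.le hε.2.le hγ.le
    set H : ℝ := (ε ^ α)⁻¹ with hH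
    have hH1 : 1 ≤ H := (one_le_inv₀ hα0).2 hα1
    set K : ℝ := (ε ^ γ)⁻¹ with hK
    have hK1 : 1 ≤ K := (one_le_inv₀ hγ0).2 hγ1
    have hH0 : 0 < H := by linarith
    have hK0 : 0 < K := by linarith
    have huc : ∀ t ∈ Ici (0:ℝ), Continuous fun x => u ε x t := fun t ht =>
      (hu_diff ε hε t ht).continuous
    have hup : ∀ t ∈ Ici (0:ℝ), Function.Periodic (fun x => u ε x t) (2 * π) := fun t ht x =>
      hu_per ε hε x t ht
    have huM : ∀ t ∈ Ici (0:ℝ), ∀ x, |u ε x t| ≤ M₁ := fun t ht x => hu_bdd ε hε x t ht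
    have hXp : ∀ t ∈ Ici (0:ℝ), Function.Periodic (X ε t) (2 * π) := hXper ε hε
    have hwp : ∀ t ∈ Ici (0:ℝ), Function.Periodic (w ε t) (2 * π) := hwper ε hε
    have hZp : ∀ t ∈ Ici (0:ℝ), Function.Periodic (Z ε t) (2 * π) := hZper ε hε
    have hX00 : periodNorm (X ε 0) ≤ C₀ := by
      rw [show (X ε 0 : ℝ → ℝ) = v₀ ε from funext (hX0 ε hε)]; exact hv₀i ε hε
    have hw00 : periodNorm (w ε 0) ≤ C₀' := by
      rw [show (w ε 0 : ℝ → ℝ) = w₀ ε from funext (hw0 ε hε)]; exact hw₀i ε hε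
    have hZ00 : periodNorm (Z ε 0) ≤ C₀'' := by
      rw [show (Z ε 0 : ℝ → ℝ) = Z₀ ε from funext (hZ0 ε hε)]; exact hZ₀i ε hε
    have hvm : ∀ t, (fun x => v ε x t) = mollify φ (ε ^ α) (X ε t) := fun t =>
      funext fun x => hv ε hε x t
    have hvc : ∀ t, Continuous fun x => v ε x t := fun t => by
      rw [hvm]; exact continuous_mollify hφ1'.continuous hφc hα0 hα1 (X ε t).continuous
    have hvp : ∀ t ∈ Ici (0:ℝ), Function.Periodic (fun x => v ε x t) (2 * π) := fun t ht => by
      rw [hvm]; exact periodic_mollify (hXp t ht) _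
    have hvd : ∀ t, deriv (fun x => v ε x t) = fun x => H * mollify (deriv φ) (ε ^ α) (X ε t) x :=
      fun t => funext fun x => by
        rw [hvm]; exact (hasDerivAt_mollify hφ1' hφc hα0 hα1 (X ε t).continuous x).deriv
    have hdc : ∀ t, Continuous (mollify (deriv φ) (ε ^ α) (X ε t)) := fun t =>
      continuous_mollify hφ' hφc.deriv hα0 hα1 (X ε t).continuous
    have hXle : ∀ t ∈ Icc (0:ℝ) δ, periodNorm (X ε t) ≤ C₀ := fun t ht => by
      obtain ⟨X', -, hX', hXeq⟩ := hX ε hε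
      have := periodNorm_le_of_hasDerivWithinAt (q := fun t x => u ε x t) (g := fun _ _ => 0)
        (G := 0) (δ := δ) hε0 hM₁ hX' hXp huc hup huM
        (fun t ht x => by rw [hXeq t ht x, upwind, add_zero]) (by simp [periodNorm]) t ht
      linarith
    have hvle : ∀ t ∈ Icc (0:ℝ) δ, ∀ x, |v ε x t| ≤ A * C₀ * H := fun t ht x => by
      rw [show v ε x t = mollify φ (ε ^ α) (X ε t) x from hv ε hε x t]
      refine (hAle _ hα0 hα1 _ (X ε t).continuous (hXp t ht.1) x).trans ?_
      rw [mul_right_comm]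
      gcongr
      exact hXle t ht
    have hsource : ∀ t ∈ Icc (0:ℝ) δ, periodNorm (fun x =>
        -((n : ℝ) * (v ε x t) ^ (n - 1) * deriv (fun z => v ε z t) x)) ≤ E * H ^ n := by
      intro t ht
      have h1 := periodNorm_mul_le (a := fun x => -((n : ℝ) * (v ε x t) ^ (n - 1) * H))
        (b := mollify (deriv φ) (ε ^ α) (X ε t)) (by have := hvc t; fun_prop) (hdc t)
        (A := n * (A * C₀ * H) ^ (n - 1) * H) fun x => by
          rw [abs_neg, abs_mul, abs_mul, abs_pow, abs_of_pos hH0, Nat.abs_cast]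
          gcongr
          exact hvle t ht x
      have h2 := periodNorm_mollify_le hφ' hφc.deriv hα0 hα1 (X ε t).continuous (hXp t ht.1)
      rw [← hI] at h2
      simp only [hvd]
      calc _ ≤ n * (A * C₀ * H) ^ (n - 1) * H * periodNorm (mollify (deriv φ) (ε ^ α) (X ε t)) := by
            convert h1 using 3
            ring
        _ ≤ n * (A * C₀ * H) ^ (n - 1) * H * (I * C₀) := by
            gcongr
            exact h2.trans (by gcongr; exact hXle t ht)
        _ = E * H ^ n := by
            obtain ⟨k, rfl⟩ : ∃ k, n = k + 1 := ⟨n - 1, by omega⟩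
            rw [hE, Nat.add_sub_cancel, mul_pow, pow_succ H]
            ring
    have hwle : ∀ t ∈ Icc (0:ℝ) δ, periodNorm (w ε t) ≤ (C₀' + E * δ) * H ^ n := fun t ht => by
      obtain ⟨w', -, hw', hweq⟩ := hw ε hε
      have h1 := periodNorm_le_of_hasDerivWithinAt (q := fun t x => u ε x t) hε0 hM₁ hw' hwp
        huc hup huM (fun t ht x => by rw [hweq t ht x, upwind, sub_eq_add_neg]) hsource t ht
      have h2 : 1 ≤ H ^ n := one_le_pow₀ hH1
      calc _ ≤ C₀' * H ^ n + E * H ^ n * δ := by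
            refine h1.trans (add_le_add (hw00.trans (le_mul_of_one_le_right hC₀' h2)) ?_)
            gcongr
            exact ht.2
        _ = _ := by ring
    have hvwc : ∀ t, Continuous fun x => v ε x t * w ε t x := fun t =>
      (hvc t).mul (w ε t).continuous
    have hvwp : ∀ t ∈ Ici (0:ℝ), Function.Periodic (fun x => v ε x t * w ε t x) (2 * π) :=
      fun t ht => (hvp t ht).mul (hwp t ht)
    have hvwle : ∀ t ∈ Icc (0:ℝ) δ, periodNorm (fun x => v ε x t * w ε t x) ≤ F * H ^ (n + 1) :=
      fun t ht => by
        refine (periodNorm_mul_le (hvc t) (w ε t).continuous (hvle t ht)).trans ?_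
        calc _ ≤ A * C₀ * H * ((C₀' + E * δ) * H ^ n) := by gcongr; exact hwle t ht
          _ = _ := by rw [hF, pow_succ]; ring
    have hflux : ∀ t, deriv (mollify φ (ε ^ γ) fun x => v ε x t * w ε t x)
        = fun x => K * mollify (deriv φ) (ε ^ γ) (fun x => v ε x t * w ε t x) x := fun t =>
      funext fun x => (hasDerivAt_mollify hφ1' hφc hγ0 hγ1 (hvwc t) x).deriv
    have hfc : ∀ t, Continuous (mollify (deriv φ) (ε ^ γ) fun x => v ε x t * w ε t x) := fun t =>
      continuous_mollify hφ' hφc.deriv hγ0 hγ1 (hvwc t)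
    have hfluxle : ∀ t ∈ Icc (0:ℝ) δ, periodNorm (fun x =>
        -deriv (mollify φ (ε ^ γ) fun x => v ε x t * w ε t x) x)
        ≤ K * (I * (F * H ^ (n + 1))) := fun t ht => by
      have h1 := periodNorm_mul_le (a := fun _ => -K) continuous_const (hfc t) (A := K)
        fun _ => by rw [abs_neg, abs_of_pos hK0]
      have h2 := periodNorm_mollify_le hφ' hφc.deriv hγ0 hγ1 (hvwc t) (hvwp t ht.1)
      rw [← hI] at h2
      simp only [hflux, ← neg_mul]
      refine h1.trans ?_
      gcongr
      exact h2.trans (by gcongr; exact hvwle t ht)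
    obtain ⟨Z', -, hZ', hZeq⟩ := hZ ε hε
    have hZeq' : ∀ t ∈ Ici (0:ℝ), ∀ x, Z' t x = upwind ε (fun x => u ε x t) (Z ε t) x
        + -deriv (mollify φ (ε ^ γ) fun x => v ε x t * w ε t x) x := fun t ht x => by
      rw [hZeq t ht x, ← sub_eq_add_neg, upwind]
      rfl
    have hZle : ∀ t ∈ Icc (0:ℝ) δ, periodNorm (Z ε t)
        ≤ (C₀'' + I * F * δ) * (K * H ^ (n + 1)) := fun t ht => by
      have h1 := periodNorm_le_of_hasDerivWithinAt (q := fun t x => u ε x t) hε0 hM₁ hZ' hZp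
        huc hup huM hZeq' hfluxle t ht
      have h2 : 1 ≤ K * H ^ (n + 1) := one_le_mul_of_one_le_of_one_le hK1 (one_le_pow₀ hH1)
      calc _ ≤ C₀'' * (K * H ^ (n + 1)) + K * (I * (F * H ^ (n + 1))) * δ := by
            refine h1.trans (add_le_add (hZ00.trans (le_mul_of_one_le_right hC₀'' h2)) ?_)
            gcongr
            exact ht.2
        _ = _ := by ring
    intro t ht
    have ht0 : t ∈ Ici (0:ℝ) := ht.1
    have hder : ∀ x, derivWithin (fun s => Z ε s x) (Ici 0) t = Z' t x := fun x => by
      let L : BoundedContinuousFunction ℝ ℝ →L[ℝ] ℝ := BoundedContinuousFunction.evalCLM ℝ x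
      have h1 : HasDerivWithinAt (fun s => Z ε s x) (Z' t x) (Ici 0) t :=
        L.hasFDerivAt.comp_hasDerivWithinAt t (hZ' t ht0)
      exact h1.derivWithin (uniqueDiffOn_Ici 0 t ht0)
    have hψc0 := hψ2.continuous
    have hψc1 : Continuous (deriv ψ) := hψ2.continuous_deriv one_le_two
    have hut := huc t ht0
    have hup' := continuous_upwind (ε := ε) hut (Z ε t).continuous
    have i1 : Integrable fun x => upwind ε (fun x => u ε x t) (Z ε t) x * ψ x
        - u ε x t * Z ε t x * deriv ψ x :=
      ((hup'.mul hψc0).integrable_of_hasCompactSupport hψc.mul_left).sub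
        (((hut.mul (Z ε t).continuous).mul hψc1).integrable_of_hasCompactSupport
          hψc.deriv.mul_left)
    have i2 : Integrable fun x => -deriv (mollify φ (ε ^ γ) fun x => v ε x t * w ε t x) x * ψ x
        - v ε x t * w ε t x * deriv ψ x := by
      have := hfc t
      rw [hflux]
      exact (Continuous.integrable_of_hasCompactSupport (by fun_prop) hψc.mul_left).sub
        (((hvwc t).mul hψc1).integrable_of_hasCompactSupport hψc.deriv.mul_left)
    have split : ∀ x, derivWithin (fun s => Z ε s x) (Ici 0) t * ψ x
        - u ε x t * Z ε t x * deriv ψ x - v ε x t * w ε t x * deriv ψ x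
        = (upwind ε (fun x => u ε x t) (Z ε t) x * ψ x - u ε x t * Z ε t x * deriv ψ x)
          + (-deriv (mollify φ (ε ^ γ) fun x => v ε x t * w ε t x) x * ψ x
            - v ε x t * w ε t x * deriv ψ x) := fun x => by
      rw [hder, hZeq' t ht0]; ring
    simp only [split]
    rw [integral_add i1 i2]
    refine (abs_add_le _ _).trans (add_le_add ?_ ?_)
    · refine (hDle ε hε0 hε.2.le (fun x => u ε x t) (Z ε t) hut (Z ε t).continuous (hZp t ht0) M₁
        (huM t ht0)).trans ?_
      calc _ ≤ D * M₁ * ε * ((C₀'' + I * F * δ) * (K * H ^ (n + 1))) := by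
            gcongr
            exact hZle t ht
        _ = _ := by ring
    · refine (hBle _ hγ0 hγ1 _ (hvwc t) (hvwp t ht0)).trans ?_
      calc _ ≤ B * ε ^ γ * (F * H ^ (n + 1)) := by
            gcongr
            exact hvwle t ht
        _ = _ := by ring
  have hpow : ∀ p > (0:ℝ), Tendsto (fun ε : ℝ => ε ^ p) (𝓝 0) (𝓝 0) := fun p hp => by
    simpa [zero_rpow hp.ne'] using (continuousAt_rpow_const 0 p (Or.inr hp.le)).tendsto
  have hlim : Tendsto (fun ε : ℝ => D * M₁ * (C₀'' + I * F * δ) * ε ^ (1 - γ - (n + 1) * α)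
      + B * F * ε ^ (γ - (n + 1) * α)) (𝓝 0) (𝓝 0) := by
    simpa using ((hpow _ (by nlinarith)).const_mul (D * M₁ * (C₀'' + I * F * δ))).add
      ((hpow _ (by nlinarith)).const_mul (B * F))
  intro η hη
  obtain ⟨ε₀, hε₀, hlt⟩ := Metric.eventually_nhds_iff.1 (hlim.eventually_lt_const hη)
  refine ⟨ε₀, hε₀, fun ε hε hεε₀ t ht => (key ε hε t ht).trans_lt ?_⟩
  have hε0 := hε.1
  have hH : (ε ^ α)⁻¹ ^ (n + 1) = ε ^ (-((n + 1) * α)) := by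
    rw [← rpow_neg hε0.le, ← rpow_natCast, ← rpow_mul hε0.le]
    congr 1
    push_cast
    ring
  have e1 : ε * (ε ^ γ)⁻¹ * (ε ^ α)⁻¹ ^ (n + 1) = ε ^ (1 - γ - (n + 1) * α) := by
    rw [hH, ← rpow_neg hε0.le, sub_eq_add_neg _ (_ * _), sub_eq_add_neg, rpow_add hε0,
      rpow_add hε0, rpow_one]
  have e2 : ε ^ γ * (ε ^ α)⁻¹ ^ (n + 1) = ε ^ (γ - (n + 1) * α) := by
    rw [hH, sub_eq_add_neg, rpow_add hε0]
  rw [e1, e2]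
  exact hlt (by rw [dist_zero_right, norm_eq_abs, abs_of_pos hε0]; exact hεε₀)
end

section
/- (Lemma 4.) Let ε ∈ (0,1), let u, v : ℝ² × [0,∞) → ℝ be continuous, bounded, and 2π-periodic in each space variable, and let ρ₀ ∈ C_b(ℝ²) be 2π-periodic in each variable. Let X : [0,∞) → C_b(ℝ²) be a continuously differentiable curve, 2π-periodic in each space variable, with X(·,·,0) = ρ₀ and ∂ₜX(x,y,t) = (1/ε)[X(x−ε,y,t)u(x−ε,y,t)⁺ − X(x,y,t)|u(x,y,t)| + X(x+ε,y,t)u(x+ε,y,t)⁻ + X(x,y−ε,t)v(x,y−ε,t)⁺ − X(x,y,t)|v(x,y,t)| + X(x,y+ε,t)v(x,y+ε,t)⁻]. Then for all t ≥ 0, ∫_{−π}^{π}∫_{−π}^{π}|X(x,y,t)| dx dy ≤ ∫_{−π}^{π}∫_{−π}^{π}|ρ₀(x,y)| dx dy. -/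
open MeasureTheory Set Real
open scoped Topology

/-- The iterated integral of a function of two variables over the square `[-π, π]²`. -/
noncomputable def squareIntegral (g : ℝ → ℝ → ℝ) : ℝ :=
  ∫ x in (-π)..π, ∫ y in (-π)..π, g x y

namespace squareIntegral

lemma continuous_inner {g : ℝ → ℝ → ℝ} (hg : Continuous (Function.uncurry g)) :
    Continuous fun x => ∫ y in (-π)..π, g x y :=
  intervalIntegral.continuous_parametric_intervalIntegral_of_continuous' hg _ _

lemma intervalIntegrable_inner {g : ℝ → ℝ → ℝ} (hg : Continuous (Function.uncurry g)) (x : ℝ) :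
    IntervalIntegrable (g x) volume (-π) π :=
  (hg.comp (Continuous.prodMk_right x)).intervalIntegrable _ _

lemma mono {f g : ℝ → ℝ → ℝ} (hf : Continuous (Function.uncurry f))
    (hg : Continuous (Function.uncurry g)) (h : ∀ x y, f x y ≤ g x y) :
    squareIntegral f ≤ squareIntegral g := by
  have hπ : -π ≤ π := by linarith [pi_pos]
  exact intervalIntegral.integral_mono hπ ((continuous_inner hf).intervalIntegrable _ _)
    ((continuous_inner hg).intervalIntegrable _ _) fun x =>
      intervalIntegral.integral_mono hπ (intervalIntegrable_inner hf x)
        (intervalIntegrable_inner hg x) (h x)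

lemma add {f g : ℝ → ℝ → ℝ} (hf : Continuous (Function.uncurry f))
    (hg : Continuous (Function.uncurry g)) :
    squareIntegral (fun x y => f x y + g x y) = squareIntegral f + squareIntegral g := by
  unfold squareIntegral
  rw [← intervalIntegral.integral_add ((continuous_inner hf).intervalIntegrable _ _)
    ((continuous_inner hg).intervalIntegrable _ _)]
  congr 1
  ext x
  exact intervalIntegral.integral_add (intervalIntegrable_inner hf x)
    (intervalIntegrable_inner hg x)

lemma const_mul (c : ℝ) (f : ℝ → ℝ → ℝ) :
    squareIntegral (fun x y => c * f x y) = c * squareIntegral f := by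
  simp [squareIntegral, intervalIntegral.integral_const_mul]

lemma const (c : ℝ) : squareIntegral (fun _ _ => c) = 4 * π ^ 2 * c := by
  simp only [squareIntegral, intervalIntegral.integral_const, smul_eq_mul]
  ring

lemma integral_comp_add_of_periodic {f : ℝ → ℝ} (hf : Function.Periodic f (2 * π)) (a : ℝ) :
    ∫ x in (-π)..π, f (x + a) = ∫ x in (-π)..π, f x := by
  rw [intervalIntegral.integral_comp_add_right]
  have h := hf.intervalIntegral_add_eq (-π + a) (-π)
  rwa [show -π + a + 2 * π = π + a by ring, show -π + 2 * π = π by ring] at h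

lemma comp_add_left {g : ℝ → ℝ → ℝ} (hg : ∀ x y, g (x + 2 * π) y = g x y) (a : ℝ) :
    squareIntegral (fun x y => g (x + a) y) = squareIntegral g :=
  integral_comp_add_of_periodic (f := fun x => ∫ y in (-π)..π, g x y)
    (fun x => by simp only [hg]) a

lemma comp_add_right {g : ℝ → ℝ → ℝ} (hg : ∀ x y, g x (y + 2 * π) = g x y) (a : ℝ) :
    squareIntegral (fun x y => g x (y + a)) = squareIntegral g := by
  unfold squareIntegral
  congr 1
  ext x
  exact integral_comp_add_of_periodic (f := g x) (hg x) a

lemma abs_le_add_norm_sub (f g : BoundedContinuousFunction (ℝ × ℝ) ℝ) :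
    squareIntegral (fun x y => |f (x, y)|) ≤
      squareIntegral (fun x y => |g (x, y)|) + 4 * π ^ 2 * ‖f - g‖ := by
  have hg : Continuous (Function.uncurry fun x y => |g (x, y)|) := g.continuous.abs
  have hc : Continuous (Function.uncurry fun _ _ : ℝ => ‖f - g‖) := continuous_const
  rw [← const, ← add hg hc]
  refine mono f.continuous.abs (hg.add hc) fun x y => ?_
  have h := (f - g).norm_coe_le_norm (x, y)
  rw [BoundedContinuousFunction.sub_apply, Real.norm_eq_abs] at h
  linarith [abs_sub_abs_le_abs_sub (f (x, y)) (g (x, y))]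

lemma continuous_abs :
    Continuous fun f : BoundedContinuousFunction (ℝ × ℝ) ℝ =>
      squareIntegral (fun x y => |f (x, y)|) :=
  (LipschitzWith.of_le_add_mul (4 * π ^ 2).toNNReal fun f g => by
    rw [Real.coe_toNNReal _ (by positivity), dist_eq_norm]
    exact abs_le_add_norm_sub f g).continuous

end squareIntegral

/-- The upwind transport operator with velocity field `(u, v)` and mesh size `ε`, up to the
factor `1 / ε`. -/
noncomputable def upwindFlux (ε : ℝ) (u v w : ℝ → ℝ → ℝ) (x y : ℝ) : ℝ :=
  w (x - ε) y * max (u (x - ε) y) 0 - w x y * |u x y| + w (x + ε) y * max (-(u (x + ε) y)) 0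
    + w x (y - ε) * max (v x (y - ε)) 0 - w x y * |v x y|
    + w x (y + ε) * max (-(v x (y + ε))) 0

lemma abs_add_mul_upwindFlux_le (ε : ℝ) {c M N : ℝ} (hc : 0 ≤ c) (hcM : c * (M + N) ≤ 1)
    {u v : ℝ → ℝ → ℝ} (hu : ∀ x y, |u x y| ≤ M) (hv : ∀ x y, |v x y| ≤ N)
    (w : ℝ → ℝ → ℝ) (x y : ℝ) :
    |w x y + c * upwindFlux ε u v w x y| ≤
      (|w x y| + c * (-(|w x y| * |u x y|) + -(|w x y| * |v x y|)))
        + c * ((|w (x + -ε) y| * max (u (x + -ε) y) 0 + |w (x + ε) y| * max (-(u (x + ε) y)) 0)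
          + (|w x (y + -ε)| * max (v x (y + -ε)) 0
            + |w x (y + ε)| * max (-(v x (y + ε))) 0)) := by
  have hd : 0 ≤ 1 - c * (|u x y| + |v x y|) := by
    nlinarith [mul_le_mul_of_nonneg_left (add_le_add (hu x y) (hv x y)) hc]
  have hmax : ∀ a b : ℝ, |a * max b 0| = |a| * max b 0 := fun a b => by
    rw [abs_mul, abs_of_nonneg (le_max_right b 0)]
  have split : w x y + c * upwindFlux ε u v w x y =
      w x y * (1 - c * (|u x y| + |v x y|))
        + c * ((w (x + -ε) y * max (u (x + -ε) y) 0 + w (x + ε) y * max (-(u (x + ε) y)) 0)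
          + (w x (y + -ε) * max (v x (y + -ε)) 0
            + w x (y + ε) * max (-(v x (y + ε))) 0)) := by
    simp only [upwindFlux, sub_eq_add_neg]
    ring
  rw [split]
  refine (abs_add_le _ _).trans (add_le_add (le_of_eq ?_) ?_)
  · rw [abs_mul, abs_of_nonneg hd]
    ring
  · rw [abs_mul, abs_of_nonneg hc]
    refine mul_le_mul_of_nonneg_left ?_ hc
    refine (abs_add_le _ _).trans (add_le_add ?_ ?_) <;>
    · refine (abs_add_le _ _).trans ?_
      rw [hmax, hmax]

/-- An explicit Euler step of the upwind scheme does not increase the `L¹`-norm under a CFL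
condition. -/
lemma squareIntegral_abs_add_mul_upwindFlux_le (ε : ℝ) {c M N : ℝ} (hc : 0 ≤ c)
    (hcM : c * (M + N) ≤ 1) {u v w : ℝ → ℝ → ℝ}
    (hu : ∀ x y, |u x y| ≤ M) (hv : ∀ x y, |v x y| ≤ N)
    (hu_cont : Continuous (Function.uncurry u)) (hv_cont : Continuous (Function.uncurry v))
    (hw_cont : Continuous (Function.uncurry w))
    (hu_per : ∀ x y, u (x + 2 * π) y = u x y) (hv_per : ∀ x y, v x (y + 2 * π) = v x y)
    (hw_per : ∀ x y, w (x + 2 * π) y = w x y ∧ w x (y + 2 * π) = w x y) :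
    squareIntegral (fun x y => |w x y + c * upwindFlux ε u v w x y|) ≤
      squareIntegral (fun x y => |w x y|) := by
  have cu : ∀ {f g : ℝ × ℝ → ℝ}, Continuous f → Continuous g →
      Continuous fun p => u (f p) (g p) := fun hf hg => hu_cont.comp (hf.prodMk hg)
  have cv : ∀ {f g : ℝ × ℝ → ℝ}, Continuous f → Continuous g →
      Continuous fun p => v (f p) (g p) := fun hf hg => hv_cont.comp (hf.prodMk hg)
  have cw : ∀ {f g : ℝ × ℝ → ℝ}, Continuous f → Continuous g →
      Continuous fun p => w (f p) (g p) := fun hf hg => hw_cont.comp (hf.prodMk hg)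
  have parts : ∀ f : ℝ → ℝ → ℝ, Continuous (Function.uncurry f) →
      squareIntegral (fun x y => |w x y| * max (f x y) 0)
        + squareIntegral (fun x y => |w x y| * max (-(f x y)) 0)
        + squareIntegral (fun x y => -(|w x y| * |f x y|)) = 0 := by
    intro f hf
    have cf : Continuous fun p : ℝ × ℝ => f p.1 p.2 := hf
    have c0 : Continuous fun p : ℝ × ℝ => w p.1 p.2 := hw_cont
    rw [← squareIntegral.add, ← squareIntegral.add]
    · have : (fun x y => |w x y| * max (f x y) 0 + |w x y| * max (-(f x y)) 0
          + -(|w x y| * |f x y|)) = fun _ _ => 0 := by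
        ext x y
        rcases le_total 0 (f x y) with h | h
        · rw [max_eq_left h, max_eq_right (by linarith), abs_of_nonneg h]; ring
        · rw [max_eq_right h, max_eq_left (by linarith), abs_of_nonpos h]; ring
      rw [this, squareIntegral.const, mul_zero]
    all_goals simp only [Function.uncurry_def]; fun_prop
  have shift₁ := squareIntegral.comp_add_left (g := fun x y => |w x y| * max (u x y) 0)
    (fun x y => by simp only [hu_per, (hw_per _ _).1]) (-ε)
  have shift₂ := squareIntegral.comp_add_left (g := fun x y => |w x y| * max (-(u x y)) 0)
    (fun x y => by simp only [hu_per, (hw_per _ _).1]) ε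
  have shift₃ := squareIntegral.comp_add_right (g := fun x y => |w x y| * max (v x y) 0)
    (fun x y => by simp only [hv_per, (hw_per _ _).2]) (-ε)
  have shift₄ := squareIntegral.comp_add_right (g := fun x y => |w x y| * max (-(v x y)) 0)
    (fun x y => by simp only [hv_per, (hw_per _ _).2]) ε
  have hpu := parts u hu_cont
  have hpv := parts v hv_cont
  refine (squareIntegral.mono ?_ ?_
    (abs_add_mul_upwindFlux_le ε hc hcM hu hv w)).trans (le_of_eq ?_)
  · simp only [Function.uncurry_def, upwindFlux]
    fun_prop (disch := fun_prop)
  · simp only [Function.uncurry_def]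
    fun_prop (disch := fun_prop)
  · rw [squareIntegral.add, squareIntegral.add, squareIntegral.const_mul, squareIntegral.add,
      squareIntegral.const_mul, squareIntegral.add, squareIntegral.add, squareIntegral.add,
      shift₁, shift₂, shift₃, shift₄]
    · linear_combination c * hpu + c * hpv
    all_goals
      simp only [Function.uncurry_def]
      fun_prop (disch := fun_prop)

/-- Lemma 4: the `L¹`-norm on a period square of a `2π`-periodic solution of the 2-D
discrete transport ODE is nonincreasing in time. -/
theorem stmt10 (ε : ℝ) (hε : ε ∈ Ioo (0:ℝ) 1)
    (u v : ℝ → ℝ → ℝ → ℝ) -- `u x y t`, `v x y t`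
    (hu_cont : ContinuousOn (fun p : (ℝ × ℝ) × ℝ => u p.1.1 p.1.2 p.2)
      (univ ×ˢ Ici 0))
    (hv_cont : ContinuousOn (fun p : (ℝ × ℝ) × ℝ => v p.1.1 p.1.2 p.2)
      (univ ×ˢ Ici 0))
    (hu_bdd : ∃ M : ℝ, ∀ x y : ℝ, ∀ t ∈ Ici (0:ℝ), |u x y t| ≤ M)
    (hv_bdd : ∃ M : ℝ, ∀ x y : ℝ, ∀ t ∈ Ici (0:ℝ), |v x y t| ≤ M)
    (hu_per : ∀ x y : ℝ, ∀ t ∈ Ici (0:ℝ),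
      u (x + 2*π) y t = u x y t ∧ u x (y + 2*π) t = u x y t)
    (hv_per : ∀ x y : ℝ, ∀ t ∈ Ici (0:ℝ),
      v (x + 2*π) y t = v x y t ∧ v x (y + 2*π) t = v x y t)
    (ρ₀ : BoundedContinuousFunction (ℝ × ℝ) ℝ)
    (hρ₀per : ∀ x y : ℝ, ρ₀ (x + 2*π, y) = ρ₀ (x, y) ∧ ρ₀ (x, y + 2*π) = ρ₀ (x, y))
    (X : ℝ → BoundedContinuousFunction (ℝ × ℝ) ℝ)
    (hX0 : X 0 = ρ₀)
    (hXper : ∀ t ∈ Ici (0:ℝ), ∀ x y : ℝ,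
      X t (x + 2*π, y) = X t (x, y) ∧ X t (x, y + 2*π) = X t (x, y))
    (hX : ∃ X' : ℝ → BoundedContinuousFunction (ℝ × ℝ) ℝ,
      ContinuousOn X' (Ici 0) ∧
      (∀ t ∈ Ici (0:ℝ), HasDerivWithinAt X (X' t) (Ici 0) t) ∧
      (∀ t ∈ Ici (0:ℝ), ∀ x y : ℝ,
        X' t (x, y) = ε⁻¹ * (X t (x - ε, y) * max (u (x - ε) y t) 0
          - X t (x, y) * |u x y t| + X t (x + ε, y) * max (-(u (x + ε) y t)) 0
          + X t (x, y - ε) * max (v x (y - ε) t) 0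
          - X t (x, y) * |v x y t| + X t (x, y + ε) * max (-(v x (y + ε) t)) 0))) :
    ∀ t ∈ Ici (0:ℝ),
      (∫ x in (-π)..π, ∫ y in (-π)..π, |X t (x, y)|) ≤
        ∫ x in (-π)..π, ∫ y in (-π)..π, |ρ₀ (x, y)| := by
  obtain ⟨M, hM⟩ := hu_bdd
  obtain ⟨N, hN⟩ := hv_bdd
  obtain ⟨X', -, hderiv, hX'⟩ := hX
  obtain ⟨hε0, -⟩ := hε
  subst hX0
  intro T hT
  rw [mem_Ici] at hT
  refine image_le_of_liminf_slope_right_le_deriv_boundary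
    (f := fun t => squareIntegral fun x y => |X t (x, y)|)
    (B := fun _ => squareIntegral fun x y => |X 0 (x, y)|) (B' := fun _ => 0)
    (a := 0) (b := T) ?_ le_rfl continuousOn_const (fun _ _ => hasDerivWithinAt_const ..) ?_
    ⟨hT, le_rfl⟩
  · exact squareIntegral.continuous_abs.comp_continuousOn fun t ht =>
      ((hderiv t ht.1).continuousWithinAt).mono Icc_subset_Ici_self
  intro t ht r hr
  have ht0 : t ∈ Ici (0 : ℝ) := ht.1
  refine Filter.Eventually.frequently ?_
  have hδ : 0 < r / (2 * (4 * π ^ 2)) := by positivity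
  have hlittle := ((hderiv t ht0).mono (s := Ioi t)
    (fun s hs => ht.1.trans (le_of_lt hs))).isLittleO.def hδ
  have hsmall : ∀ᶠ z in 𝓝[>] t, ε⁻¹ * (z - t) * (M + N) < 1 := by
    refine nhdsWithin_le_nhds (ContinuousAt.eventually_lt ?_ continuousAt_const ?_)
    · fun_prop
    · simp
  have slice : ∀ {f : ℝ → ℝ → ℝ → ℝ},
      ContinuousOn (fun p : (ℝ × ℝ) × ℝ => f p.1.1 p.1.2 p.2) (univ ×ˢ Ici 0) →
      Continuous (Function.uncurry fun x y => f x y t) := fun hf =>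
    hf.comp_continuous (Continuous.prodMk_left t) fun p => ⟨mem_univ _, ht0⟩
  filter_upwards [hlittle, hsmall, self_mem_nhdsWithin] with z hz hzs hzt
  have hpos : 0 < z - t := sub_pos.2 hzt
  have step := squareIntegral_abs_add_mul_upwindFlux_le ε (by positivity) hzs.le
    (u := fun x y => u x y t) (v := fun x y => v x y t) (w := fun x y => X t (x, y))
    (fun x y => hM x y t ht0) (fun x y => hN x y t ht0) (slice hu_cont) (slice hv_cont)
    (X t).continuous (fun x y => (hu_per x y t ht0).1) (fun x y => (hv_per x y t ht0).2)
    (fun x y => hXper t ht0 x y)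
  have euler := squareIntegral.abs_le_add_norm_sub (X z) (X t + (z - t) • X' t)
  have heq : (fun x y => |(X t + (z - t) • X' t) (x, y)|) = fun x y => |X t (x, y) +
      ε⁻¹ * (z - t) * upwindFlux ε (fun x y => u x y t) (fun x y => v x y t)
        (fun x y => X t (x, y)) x y| := by
    ext x y
    congr 1
    simp only [BoundedContinuousFunction.add_apply, BoundedContinuousFunction.smul_apply,
      smul_eq_mul, hX' t ht0 x y, upwindFlux]
    ring
  rw [heq, ← sub_sub] at euler
  rw [Real.norm_of_nonneg hpos.le] at hz
  have herr := mul_le_mul_of_nonneg_left hz (by positivity : 0 ≤ 4 * π ^ 2)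
  have hhalf : 4 * π ^ 2 * (r / (2 * (4 * π ^ 2)) * (z - t)) = r / 2 * (z - t) := by
    field_simp
  rw [slope_def_field, div_lt_iff₀ hpos]
  nlinarith [mul_pos hr hpos]
end

section
/- Let 0 < β < α ≤ 1. Assume: (u_ε), (v_ε) are families (ε ∈ (0,1)) of continuous functions ℝ² × [0,∞) → ℝ, C¹ in the space variables, 2π-periodic in each space variable, uniformly bounded by M₁, and such that for every δ > 0 there is C_δ with |∂ₓu_ε|, |∂_yu_ε|, |∂ₓv_ε|, |∂_yv_ε| ≤ C_δ/ε^β on ℝ² × [0,δ]; (ρ₀ε) are continuous, 2π-periodic in each variable, with ∫_{−π}^{π}∫_{−π}^{π}|ρ₀ε| ≤ C₀; X_ε is the continuously differentiable curve in C_b(ℝ²), 2π-periodic in each space variable, with X_ε(·,·,0) = ρ₀ε and ∂ₜX_ε(x,y,t) = (1/ε)[(X_ε u_ε⁺)(x−ε,y,t) − (X_ε|u_ε|)(x,y,t) + (X_ε u_ε⁻)(x+ε,y,t) + (X_ε v_ε⁺)(x,y−ε,t) − (X_ε|v_ε|)(x,y,t) + (X_ε v_ε⁻)(x,y+ε,t)];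 and ρ_ε(·,·,t) = X_ε(·,·,t) * φ_{ε^α} with φ : ℝ² → ℝ a C^∞ compactly supported function of integral 1. Then for every ψ ∈ C_c^∞(ℝ²) and every δ > 0, sup_{t∈[0,δ]} |∫∫_{ℝ²} (∂ₜρ_ε(x,y,t)ψ(x,y) − u_ε(x,y,t)ρ_ε(x,y,t)∂ₓψ(x,y) − v_ε(x,y,t)ρ_ε(x,y,t)∂_yψ(x,y)) dx dy| → 0 as ε → 0; i.e. (u_ε, v_ε, ρ_ε) is a weak asymptotic method for the continuity equation ∂ₜρ + ∂ₓ(ρu) + ∂_y(ρv) = 0. -/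
open MeasureTheory Set Real

/-- The fundamental cell of the lattice `(2πℤ)²`. -/
def cell : Set (ℝ × ℝ) := Ioc (-π) π ×ˢ Ioc (-π) π

/-- `2π`-periodicity in each of two real variables. -/
def DoublyPeriodic (g : ℝ × ℝ → ℝ) : Prop :=
  ∀ x y : ℝ, g (x + 2 * π, y) = g (x, y) ∧ g (x, y + 2 * π) = g (x, y)

theorem integrableOn_Ioc_prod_of_continuous {g : ℝ × ℝ → ℝ} (hg : Continuous g) (a b c d : ℝ) :
    IntegrableOn g (Ioc a b ×ˢ Ioc c d) :=
  (hg.continuousOn.integrableOn_compact (isCompact_Icc.prod isCompact_Icc)).mono_set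
    (prod_mono Ioc_subset_Icc_self Ioc_subset_Icc_self)

theorem integrableOn_cell {g : ℝ × ℝ → ℝ} (hg : Continuous g) : IntegrableOn g cell :=
  integrableOn_Ioc_prod_of_continuous hg _ _ _ _

theorem setIntegral_Ioc_prod_eq_intervalIntegral {g : ℝ × ℝ → ℝ} (hg : Continuous g)
    {a b c d : ℝ} (hab : a ≤ b) (hcd : c ≤ d) :
    ∫ z in Ioc a b ×ˢ Ioc c d, g z = ∫ x in a..b, ∫ y in c..d, g (x, y) := by
  rw [intervalIntegral.integral_of_le hab]
  simp_rw [intervalIntegral.integral_of_le hcd]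
  exact setIntegral_prod g (integrableOn_Ioc_prod_of_continuous hg _ _ _ _)

theorem setIntegral_cell_eq_intervalIntegral {g : ℝ × ℝ → ℝ} (hg : Continuous g) :
    ∫ z in cell, g z = ∫ x in (-π)..π, ∫ y in (-π)..π, g (x, y) :=
  have h : -π ≤ π := by linarith [pi_pos]
  setIntegral_Ioc_prod_eq_intervalIntegral hg h h

theorem setIntegral_cell_shift {g : ℝ × ℝ → ℝ} (hg : Continuous g) (hp : DoublyPeriodic g)
    (a b : ℝ) : ∫ z in cell, g (z.1 + a, z.2 + b) = ∫ z in cell, g z := by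
  have periodic_shift : ∀ {f : ℝ → ℝ}, Function.Periodic f (2 * π) → ∀ s,
      ∫ x in (-π)..π, f (x + s) = ∫ x in (-π)..π, f x := by
    intro f hf s
    rw [intervalIntegral.integral_comp_add_right]
    have := hf.intervalIntegral_add_eq (-π + s) (-π)
    convert this using 2 <;> ring
  rw [setIntegral_cell_eq_intervalIntegral (g := fun z => g (z.1 + a, z.2 + b)) (by fun_prop),
    setIntegral_cell_eq_intervalIntegral hg]
  have inner : ∀ x, ∫ y in (-π)..π, g (x + a, y + b) = ∫ y in (-π)..π, g (x + a, y) :=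
    fun x => periodic_shift (f := fun y => g (x + a, y)) (fun y => (hp _ y).2) b
  simp only [inner]
  refine periodic_shift (f := fun x => ∫ y in (-π)..π, g (x, y)) (fun x => ?_) a
  simp only [(hp x _).1]

theorem setIntegral_closedBall_le_cell (r : ℝ) : ∃ N : ℝ, 0 ≤ N ∧ ∀ g : ℝ × ℝ → ℝ, Continuous g →
    DoublyPeriodic g → (∀ z, 0 ≤ g z) →
    ∫ z in Metric.closedBall 0 r, g z ≤ N * ∫ z in cell, g z := by
  obtain ⟨m, hm⟩ := exists_nat_gt (|r| / (2 * π))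
  have hpi := pi_pos
  have hm' : |r| < m * (2 * π) := (div_lt_iff₀ (by positivity)).1 hm
  set a : ℝ := -(m * (2 * π)) with ha
  set n : ℤ := 2 * m with hn
  have hab : a + n • (2 * π) = m * (2 * π) := by simp [hn, ha]; ring
  refine ⟨(n : ℝ) * n, mul_self_nonneg _, fun g hg hp h0 => ?_⟩
  have hle : a ≤ a + n • (2 * π) := by rw [hab, ha]; have := abs_nonneg r; linarith
  have hsub : Metric.closedBall (0 : ℝ × ℝ) r ⊆
      Ioc a (a + n • (2 * π)) ×ˢ Ioc a (a + n • (2 * π)) := by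
    rw [hab]
    rintro ⟨x, y⟩ hz
    rw [mem_closedBall_zero_iff] at hz
    have hx : |x| ≤ |r| := ((norm_fst_le (x, y)).trans hz).trans (le_abs_self r)
    have hy : |y| ≤ |r| := ((norm_snd_le (x, y)).trans hz).trans (le_abs_self r)
    rw [abs_le] at hx hy
    refine ⟨⟨?_, ?_⟩, ⟨?_, ?_⟩⟩ <;> simp only [ha] <;> linarith
  have tile : ∀ {f : ℝ → ℝ}, Continuous f → Function.Periodic f (2 * π) →
      ∫ x in a..a + n • (2 * π), f x = n * ∫ x in (-π)..π, f x := by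
    intro f hf hfp
    rw [hfp.intervalIntegral_add_zsmul_eq n a (fun _ _ => hf.intervalIntegrable _ _),
      hfp.intervalIntegral_add_eq a (-π), zsmul_eq_mul]
    congr 3
    ring
  calc ∫ z in Metric.closedBall 0 r, g z
      ≤ ∫ z in Ioc a (a + n • (2 * π)) ×ˢ Ioc a (a + n • (2 * π)), g z :=
        setIntegral_mono_set (integrableOn_Ioc_prod_of_continuous hg _ _ _ _)
          (Filter.Eventually.of_forall h0) hsub.eventuallyLE
    _ = (n * n : ℝ) * ∫ z in cell, g z := by
        rw [setIntegral_Ioc_prod_eq_intervalIntegral hg hle hle,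
          setIntegral_cell_eq_intervalIntegral hg, mul_assoc]
        have inner : ∀ x, ∫ y in a..a + n • (2 * π), g (x, y) = n * ∫ y in (-π)..π, g (x, y) :=
          fun x => tile (f := fun y => g (x, y)) (by fun_prop) (fun y => (hp x y).2)
        simp only [inner, intervalIntegral.integral_const_mul]
        congr 1
        refine tile (f := fun x => ∫ y in (-π)..π, g (x, y)) ?_ (fun x => ?_)
        · exact intervalIntegral.continuous_parametric_intervalIntegral_of_continuous'
            (f := fun x y => g (x, y)) hg _ _
        · simp only [(hp x _).1]

/-- The discrete transport operator with step `ε` and velocity `(u, v)`. -/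
noncomputable def discreteTransport (ε : ℝ) (u v g : ℝ × ℝ → ℝ) (z : ℝ × ℝ) : ℝ :=
  ε⁻¹ * (g (z.1 - ε, z.2) * max (u (z.1 - ε, z.2)) 0
    - g z * |u z| + g (z.1 + ε, z.2) * max (-(u (z.1 + ε, z.2))) 0
    + g (z.1, z.2 - ε) * max (v (z.1, z.2 - ε)) 0
    - g z * |v z|
    + g (z.1, z.2 + ε) * max (-(v (z.1, z.2 + ε))) 0)

theorem setIntegral_cell_abs_euler_step_le {ε M h : ℝ} (hε : 0 < ε) (hh : 0 ≤ h)
    (hstep : h * (2 * M) ≤ ε) {u v g : ℝ × ℝ → ℝ} (hu : Continuous u) (hv : Continuous v)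
    (hg : Continuous g) (hup : DoublyPeriodic u) (hvp : DoublyPeriodic v) (hgp : DoublyPeriodic g)
    (huM : ∀ z, |u z| ≤ M) (hvM : ∀ z, |v z| ≤ M) :
    ∫ z in cell, |g z + h * discreteTransport ε u v g z| ≤ ∫ z in cell, |g z| := by
  set a : ℝ × ℝ → ℝ := fun z => |g z| * max (u z) 0 with ha
  set b : ℝ × ℝ → ℝ := fun z => |g z| * max (-(u z)) 0 with hb
  set c : ℝ × ℝ → ℝ := fun z => |g z| * max (v z) 0 with hc
  set d : ℝ × ℝ → ℝ := fun z => |g z| * max (-(v z)) 0 with hd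
  have ca : Continuous a := by fun_prop
  have cb : Continuous b := by fun_prop
  have cc : Continuous c := by fun_prop
  have cd : Continuous d := by fun_prop
  have pa : DoublyPeriodic a := fun x y => by simp [ha, hgp x y, hup x y]
  have pb : DoublyPeriodic b := fun x y => by simp [hb, hgp x y, hup x y]
  have pc : DoublyPeriodic c := fun x y => by simp [hc, hgp x y, hvp x y]
  have pd : DoublyPeriodic d := fun x y => by simp [hd, hgp x y, hvp x y]
  have hk : 0 ≤ h * ε⁻¹ := by positivity
  have cT : Continuous (discreteTransport ε u v g) := by unfold discreteTransport; fun_prop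
  set S : ℝ × ℝ → ℝ := fun z => (a (z.1 + -ε, z.2 + 0) - a z) + (b (z.1 + ε, z.2 + 0) - b z)
    + (c (z.1 + 0, z.2 + -ε) - c z) + (d (z.1 + 0, z.2 + ε) - d z) with hS
  have shiftZero : ∀ {f : ℝ × ℝ → ℝ}, Continuous f → DoublyPeriodic f → ∀ s t,
      ∫ z in cell, (f (z.1 + s, z.2 + t) - f z) = 0 := by
    intro f hf hp s t
    rw [integral_sub (integrableOn_cell (by fun_prop)) (integrableOn_cell hf),
      setIntegral_cell_shift hf hp, sub_self]
  have hS0 : ∫ z in cell, S z = 0 := by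
    simp only [hS]
    rw [integral_add (integrableOn_cell (by fun_prop)) (integrableOn_cell (by fun_prop)),
      integral_add (integrableOn_cell (by fun_prop)) (integrableOn_cell (by fun_prop)),
      integral_add (integrableOn_cell (by fun_prop)) (integrableOn_cell (by fun_prop)),
      shiftZero ca pa, shiftZero cb pb, shiftZero cc pc, shiftZero cd pd]
    simp
  have cS : Continuous S := by fun_prop
  have key : ∀ z, |g z + h * discreteTransport ε u v g z| ≤ |g z| + h * ε⁻¹ * S z := by
    intro z
    have habs : ∀ r : ℝ, |r| = max r 0 + max (-r) 0 := fun r => by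
      rcases le_total 0 r with hr | hr
      · simp [abs_of_nonneg hr, hr]
      · simp [abs_of_nonpos hr, hr]
    have hθ : 0 ≤ 1 - h * ε⁻¹ * (|u z| + |v z|) := by
      have h1 : h * ε⁻¹ * (|u z| + |v z|) ≤ h * ε⁻¹ * (2 * M) := by
        gcongr; linarith [huM z, hvM z]
      have h2 : h * ε⁻¹ * (2 * M) ≤ 1 := by
        rw [show h * ε⁻¹ * (2 * M) = (h * (2 * M)) / ε by ring]
        exact (div_le_one hε).2 hstep
      linarith
    have e1 : g z + h * discreteTransport ε u v g z =
        (1 - h * ε⁻¹ * (|u z| + |v z|)) * g z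
        + h * ε⁻¹ * (g (z.1 + -ε, z.2 + 0) * max (u (z.1 + -ε, z.2 + 0)) 0)
        + h * ε⁻¹ * (g (z.1 + ε, z.2 + 0) * max (-(u (z.1 + ε, z.2 + 0))) 0)
        + h * ε⁻¹ * (g (z.1 + 0, z.2 + -ε) * max (v (z.1 + 0, z.2 + -ε)) 0)
        + h * ε⁻¹ * (g (z.1 + 0, z.2 + ε) * max (-(v (z.1 + 0, z.2 + ε))) 0) := by
      simp only [discreteTransport, add_zero, ← sub_eq_add_neg]; ring
    have e2 : |g z| + h * ε⁻¹ * S z = (1 - h * ε⁻¹ * (|u z| + |v z|)) * |g z|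
        + h * ε⁻¹ * a (z.1 + -ε, z.2 + 0) + h * ε⁻¹ * b (z.1 + ε, z.2 + 0)
        + h * ε⁻¹ * c (z.1 + 0, z.2 + -ε) + h * ε⁻¹ * d (z.1 + 0, z.2 + ε) := by
      simp only [hS, habs (u z), habs (v z)]; simp only [ha, hb, hc, hd]; ring
    have hmul : ∀ p q : ℝ, |h * ε⁻¹ * (p * max q 0)| = h * ε⁻¹ * (|p| * max q 0) := fun p q => by
      rw [abs_mul, abs_of_nonneg hk, abs_mul, abs_of_nonneg (le_max_right q 0)]
    rw [e1, e2]
    refine (abs_add_le _ _).trans (add_le_add ((abs_add_le _ _).trans (add_le_add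
      ((abs_add_le _ _).trans (add_le_add ((abs_add_le _ _).trans (add_le_add ?_ ?_)) ?_)) ?_)) ?_)
    · rw [abs_mul, abs_of_nonneg hθ]
    all_goals exact (hmul _ _).le
  calc ∫ z in cell, |g z + h * discreteTransport ε u v g z|
      ≤ ∫ z in cell, (|g z| + h * ε⁻¹ * S z) :=
        integral_mono (integrableOn_cell (by fun_prop)) (integrableOn_cell (by fun_prop)) key
    _ = ∫ z in cell, |g z| := by
        rw [integral_add (integrableOn_cell (by fun_prop)) (integrableOn_cell (by fun_prop)),
          integral_const_mul, hS0, mul_zero, add_zero]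

theorem setIntegral_cell_abs_le_add (g g' : BoundedContinuousFunction (ℝ × ℝ) ℝ) :
    ∫ z in cell, |g z| ≤ (∫ z in cell, |g' z|) + volume.real cell * dist g g' := by
  have hfin : volume cell ≠ ⊤ :=
    ((isCompact_Icc.prod isCompact_Icc).isBounded.subset
      (prod_mono Ioc_subset_Icc_self Ioc_subset_Icc_self)).measure_lt_top.ne
  have hc : IntegrableOn (fun _ : ℝ × ℝ => dist g g') cell := integrableOn_const hfin
  calc ∫ z in cell, |g z| ≤ ∫ z in cell, (|g' z| + dist g g') := by
        refine integral_mono (integrableOn_cell (by fun_prop))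
          ((integrableOn_cell (by fun_prop)).add hc) fun z => ?_
        have h1 : |g z - g' z| ≤ dist g g' := by
          rw [← Real.dist_eq]
          exact BoundedContinuousFunction.dist_coe_le_dist z
        have h2 := abs_sub_abs_le_abs_sub (g z) (g' z)
        show |g z| ≤ |g' z| + dist g g'
        linarith
    _ = _ := by
        rw [integral_add (integrableOn_cell (by fun_prop)) hc, setIntegral_const, smul_eq_mul]

theorem setIntegral_cell_abs_le_initial {ε M : ℝ} (hε : 0 < ε) {u v : ℝ → ℝ × ℝ → ℝ}
    (hu : ∀ t, 0 ≤ t → Continuous (u t)) (hv : ∀ t, 0 ≤ t → Continuous (v t))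
    (hup : ∀ t, 0 ≤ t → DoublyPeriodic (u t)) (hvp : ∀ t, 0 ≤ t → DoublyPeriodic (v t))
    (huM : ∀ t, 0 ≤ t → ∀ z, |u t z| ≤ M) (hvM : ∀ t, 0 ≤ t → ∀ z, |v t z| ≤ M)
    {X X' : ℝ → BoundedContinuousFunction (ℝ × ℝ) ℝ}
    (hXp : ∀ t, 0 ≤ t → DoublyPeriodic (X t))
    (hX : ∀ t, 0 ≤ t → HasDerivWithinAt X (X' t) (Ici 0) t)
    (hX' : ∀ t, 0 ≤ t → ∀ z, X' t z = discreteTransport ε (u t) (v t) (X t) z)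
    {t : ℝ} (ht : 0 ≤ t) : ∫ z in cell, |X t z| ≤ ∫ z in cell, |X 0 z| := by
  set V := volume.real cell with hV
  have hV0 : 0 ≤ V := measureReal_nonneg
  have hM : 0 ≤ M := (abs_nonneg _).trans (huM 0 le_rfl 0)
  have hlip : Continuous fun g : BoundedContinuousFunction (ℝ × ℝ) ℝ => ∫ z in cell, |g z| :=
    (LipschitzWith.of_le_add_mul ⟨V, hV0⟩ setIntegral_cell_abs_le_add).continuous
  have hcont : ContinuousOn (fun s => ∫ z in cell, |X s z|) (Icc 0 t) :=
    hlip.comp_continuousOn fun s hs =>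
      ((hX s hs.1).continuousWithinAt).mono Icc_subset_Ici_self
  refine image_le_of_liminf_slope_right_le_deriv_boundary hcont
    (B := fun _ => ∫ z in cell, |X 0 z|) (B' := fun _ => 0) le_rfl continuousOn_const
    (fun x _ => hasDerivWithinAt_const _ _ _) (fun s hs r hr => ?_) ⟨ht, le_rfl⟩
  have hslope : Filter.Tendsto (slope X s) (nhdsWithin s (Ioi s)) (nhds (X' s)) := by
    exact (hasDerivWithinAt_iff_tendsto_slope' self_notMem_Ioi).1
      ((hX s hs.1).mono fun z hz => hs.1.trans (le_of_lt hz))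
  have herr : Filter.Tendsto (fun z => V * dist (slope X s z) (X' s))
      (nhdsWithin s (Ioi s)) (nhds 0) := by
    simpa using (hslope.dist (tendsto_const_nhds (x := X' s))).const_mul V
  have hnear : ∀ᶠ z in nhdsWithin s (Ioi s), (z - s) * (2 * M) < ε := by
    have : Filter.Tendsto (fun z => (z - s) * (2 * M)) (nhdsWithin s (Ioi s)) (nhds 0) := by
      refine ((Continuous.tendsto' (by fun_prop) s 0 (by simp)).mono_left nhdsWithin_le_nhds)
    exact this.eventually (gt_mem_nhds hε)
  refine Filter.Eventually.frequently ?_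
  filter_upwards [herr.eventually (gt_mem_nhds hr), hnear, self_mem_nhdsWithin] with z hz hzε hzs
  have hpos : 0 < z - s := sub_pos.2 hzs
  refine lt_of_le_of_lt ?_ hz
  have hstep := setIntegral_cell_abs_euler_step_le hε hpos.le hzε.le (hu s hs.1) (hv s hs.1)
    (X s).continuous (hup s hs.1) (hvp s hs.1) (hXp s hs.1) (huM s hs.1) (hvM s hs.1)
  simp only [← hX' s hs.1] at hstep
  have hadd := setIntegral_cell_abs_le_add (X z) (X s + (z - s) • X' s)
  have hdist : dist (X z) (X s + (z - s) • X' s) = (z - s) * dist (slope X s z) (X' s) := by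
    rw [dist_eq_norm, dist_eq_norm, ← abs_of_pos hpos, ← Real.norm_eq_abs, ← norm_smul,
      Real.norm_eq_abs, abs_of_pos hpos, smul_sub, sub_smul_slope, vsub_eq_sub, sub_sub]
  rw [hdist] at hadd
  simp only [BoundedContinuousFunction.coe_add, BoundedContinuousFunction.coe_smul, Pi.add_apply,
    smul_eq_mul] at hadd
  rw [slope_def_field, div_le_iff₀ hpos]
  calc _ ≤ V * ((z - s) * dist (slope X s z) (X' s)) := by linarith
    _ = _ := by ring

theorem exists_taylor_bound {ψ : ℝ × ℝ → ℝ} (hψ : ContDiff ℝ (⊤ : ℕ∞) ψ)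
    (hψc : HasCompactSupport ψ) :
    ∃ L : ℝ, 0 ≤ L ∧ ∀ z w, |ψ (z + w) - ψ z - fderiv ℝ ψ z w| ≤ L * ‖w‖ ^ 2 := by
  obtain ⟨L, hL⟩ := ContDiff.lipschitzWith_of_hasCompactSupport (hψc.fderiv (𝕜 := ℝ))
    (hψ.fderiv_right (m := 1) (by norm_cast)) one_ne_zero
  refine ⟨L, L.2, fun z w => ?_⟩
  have := Convex.norm_image_sub_le_of_norm_hasFDerivWithin_le' (f := ψ) (f' := fderiv ℝ ψ)
    (φ := fderiv ℝ ψ z) (C := L * ‖w‖) (s := Metric.closedBall z ‖w‖) (x := z) (y := z + w)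
    (fun x _ => ((hψ.differentiable (by norm_cast)) x).hasFDerivAt.hasFDerivWithinAt)
    (fun x hx => (hL.norm_sub_le x z).trans
      (mul_le_mul_of_nonneg_left (by simpa [dist_eq_norm] using hx) L.2))
    (convex_closedBall z _) (by simp) (by simp)
  simpa [pow_two, mul_assoc] using this

theorem abs_sub_le_of_abs_partial_deriv_le {f : ℝ × ℝ → ℝ} (hf : Differentiable ℝ f) {c : ℝ}
    (hx : ∀ x y, |deriv (fun s => f (s, y)) x| ≤ c) (hy : ∀ x y, |deriv (fun s => f (x, s)) y| ≤ c)
    (z q : ℝ × ℝ) : |f (z + q) - f z| ≤ 2 * c * ‖q‖ := by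
  have hc : 0 ≤ c := (abs_nonneg _).trans (hx 0 0)
  have h1 := Convex.norm_image_sub_le_of_norm_deriv_le (𝕜 := ℝ) (f := fun s => f (s, z.2))
    (s := univ) (C := c) (x := z.1) (y := z.1 + q.1) (fun x _ => by fun_prop) (fun x _ => hx x z.2)
    convex_univ (mem_univ _) (mem_univ _)
  have h2 := Convex.norm_image_sub_le_of_norm_deriv_le (𝕜 := ℝ) (f := fun s => f (z.1 + q.1, s))
    (s := univ) (C := c) (x := z.2) (y := z.2 + q.2) (fun x _ => by fun_prop)
    (fun y _ => hy (z.1 + q.1) y) convex_univ (mem_univ _) (mem_univ _)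
  simp only [add_sub_cancel_left, Real.norm_eq_abs] at h1 h2
  have h3 : c * |q.1| ≤ c * ‖q‖ := mul_le_mul_of_nonneg_left (norm_fst_le q) hc
  have h4 : c * |q.2| ≤ c * ‖q‖ := mul_le_mul_of_nonneg_left (norm_snd_le q) hc
  have h5 := abs_sub_le (f (z + q)) (f (z.1 + q.1, z.2)) (f z)
  change |f (z.1 + q.1, z.2 + q.2) - f z| ≤ _ + |f (z.1 + q.1, z.2) - f (z.1, z.2)| at h5
  change |f (z.1 + q.1, z.2 + q.2) - f z| ≤ _
  have h6 : |f (z + q) - f (z.1 + q.1, z.2)| ≤ c * |q.2| := h2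
  linarith

theorem abs_integral_residual_le {ε M L D Λ r R : ℝ} (hε : 0 < ε) (hε1 : ε < 1)
    {u v : ℝ × ℝ → ℝ} (hu : Continuous u) (hv : Continuous v)
    (huM : ∀ z, |u z| ≤ M) (hvM : ∀ z, |v z| ≤ M) {g : ℝ × ℝ → ℝ} (hg : Continuous g)
    {ψ : ℝ × ℝ → ℝ} (hψ : ContDiff ℝ (⊤ : ℕ∞) ψ) (hψc : HasCompactSupport ψ)
    (hψr : ∀ z, ψ z ≠ 0 → ‖z‖ ≤ r) (hψr' : ∀ z, fderiv ℝ ψ z ≠ 0 → ‖z‖ ≤ r) (hL0 : 0 ≤ L)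
    (hL : ∀ z w, |ψ (z + w) - ψ z - fderiv ℝ ψ z w| ≤ L * ‖w‖ ^ 2)
    (hD : ∀ z, ‖fderiv ℝ ψ z‖ ≤ D) {q : ℝ × ℝ} (hq : ‖q‖ ≤ R)
    (huΛ : ∀ z, |u (z + q) - u z| ≤ Λ) (hvΛ : ∀ z, |v (z + q) - v z| ≤ Λ) :
    |∫ z, (discreteTransport ε u v g z * ψ (z + q)
      - g z * (u (z + q) * fderiv ℝ ψ (z + q) (1, 0) + v (z + q) * fderiv ℝ ψ (z + q) (0, 1)))|
    ≤ (2 * M * L * ε + 2 * Λ * D) * ∫ z in Metric.closedBall 0 (r + R + 1), |g z| := by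
  have hψC : Continuous ψ := hψ.continuous
  have hdψC : Continuous (fderiv ℝ ψ) := hψ.continuous_fderiv (by norm_cast)
  have hM0 : 0 ≤ M := (abs_nonneg _).trans (huM 0)
  have hΛ0 : 0 ≤ Λ := (abs_nonneg _).trans (huΛ 0)
  have hD0 : 0 ≤ D := (norm_nonneg _).trans (hD 0)
  set e₁ : ℝ × ℝ := (ε, 0) with he₁
  set e₂ : ℝ × ℝ := (0, ε) with he₂
  have n₁ : ‖e₁‖ = ε := by simp [he₁, Prod.norm_def, abs_of_pos hε, hε.le]
  have n₂ : ‖e₂‖ = ε := by simp [he₂, Prod.norm_def, abs_of_pos hε, hε.le]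
  set a : ℝ × ℝ → ℝ := fun z => g z * max (u z) 0 with ha
  set b : ℝ × ℝ → ℝ := fun z => g z * max (-(u z)) 0 with hb
  set c : ℝ × ℝ → ℝ := fun z => g z * max (v z) 0 with hc
  set d : ℝ × ℝ → ℝ := fun z => g z * max (-(v z)) 0 with hd
  have ca : Continuous a := by fun_prop
  have cb : Continuous b := by fun_prop
  have cc : Continuous c := by fun_prop
  have cd : Continuous d := by fun_prop
  have habs : ∀ r : ℝ, |r| = max r 0 + max (-r) 0 := fun r => by
    rcases le_total 0 r with hr | hr
    · simp [abs_of_nonneg hr, hr]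
    · simp [abs_of_nonpos hr, hr]
  have hself : ∀ r : ℝ, r = max r 0 - max (-r) 0 := fun r => by
    rcases le_total 0 r with hr | hr
    · simp [hr]
    · simp [hr]
  have cball : IsCompact (Metric.closedBall (0 : ℝ × ℝ) (r + R + 1)) := isCompact_closedBall _ _
  have outside : ∀ z, z ∉ Metric.closedBall (0 : ℝ × ℝ) (r + R + 1) → ∀ w, ‖w‖ ≤ ε →
      r < ‖z + q + w‖ := by
    intro z hz w hw
    rw [mem_closedBall_zero_iff, not_le] at hz
    have h1 : ‖z‖ ≤ ‖z + q + w‖ + ‖q + w‖ := by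
      have := norm_sub_le (z + q + w) (q + w)
      rwa [show z + q + w - (q + w) = z by abel] at this
    linarith [norm_add_le q w]
  have ψout : ∀ z, z ∉ Metric.closedBall (0 : ℝ × ℝ) (r + R + 1) → ∀ w, ‖w‖ ≤ ε →
      ψ (z + q + w) = 0 := fun z hz w hw => by
    by_contra hne
    exact absurd (hψr _ hne) (not_le.2 (outside z hz w hw))
  have dψout : ∀ z, z ∉ Metric.closedBall (0 : ℝ × ℝ) (r + R + 1) →
      fderiv ℝ ψ (z + q) = 0 := fun z hz => by
    by_contra hne
    have := outside z hz 0 (by simpa using hε.le)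
    rw [add_zero] at this
    exact absurd (hψr' _ hne) (not_le.2 this)
  have csupp : ∀ w, HasCompactSupport fun z => ψ (z + w) := fun w =>
    hψc.comp_homeomorph (Homeomorph.addRight w)
  have intA : ∀ {f : ℝ × ℝ → ℝ}, Continuous f → ∀ w, Integrable fun z => f (z - w) * ψ (z + q) :=
    fun hf w => (show Continuous _ by fun_prop).integrable_of_hasCompactSupport (csupp q).mul_left
  have intB : ∀ {f : ℝ × ℝ → ℝ}, Continuous f → ∀ w, Integrable fun z => f z * ψ (z + q + w) := by
    intro f hf w
    simp only [add_assoc]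
    exact (show Continuous _ by fun_prop).integrable_of_hasCompactSupport (csupp (q + w)).mul_left
  have shift : ∀ {f : ℝ × ℝ → ℝ}, Continuous f → ∀ w,
      ∫ z, (f (z - w) * ψ (z + q) - f z * ψ (z + q + w)) = 0 := by
    intro f hf w
    rw [integral_sub (intA hf w) (intB hf w),
      ← integral_sub_right_eq_self (fun z => f z * ψ (z + q + w)) w, sub_eq_zero]
    congr 1
    ext z
    congr 2
    abel
  have shiftInt : ∀ {f : ℝ × ℝ → ℝ}, Continuous f → ∀ w,
      Integrable fun z => f (z - w) * ψ (z + q) - f z * ψ (z + q + w) :=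
    fun hf w => (intA hf w).sub (intB hf w)
  set S : ℝ × ℝ → ℝ := fun z =>
    (a (z - e₁) * ψ (z + q) - a z * ψ (z + q + e₁))
    + (b (z - -e₁) * ψ (z + q) - b z * ψ (z + q + -e₁))
    + (c (z - e₂) * ψ (z + q) - c z * ψ (z + q + e₂))
    + (d (z - -e₂) * ψ (z + q) - d z * ψ (z + q + -e₂)) with hS
  have i₁ := shiftInt ca e₁
  have i₂ := shiftInt cb (-e₁)
  have i₃ := shiftInt cc e₂
  have i₄ := shiftInt cd (-e₂)
  have iS : Integrable S := ((i₁.add i₂).add i₃).add i₄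
  have hS0 : ∫ z, S z = 0 := by
    simp only [hS]
    rw [integral_add (by exact (i₁.add i₂).add i₃) i₄, integral_add (by exact i₁.add i₂) i₃,
      integral_add i₁ i₂, shift ca, shift cb, shift cc, shift cd]
    simp
  set E : ℝ × ℝ → ℝ := fun z =>
    max (u z) 0 * (ε⁻¹ * (ψ (z + q + e₁) - ψ (z + q) - fderiv ℝ ψ (z + q) e₁))
    + max (-(u z)) 0 * (ε⁻¹ * (ψ (z + q + -e₁) - ψ (z + q) - fderiv ℝ ψ (z + q) (-e₁)))
    + max (v z) 0 * (ε⁻¹ * (ψ (z + q + e₂) - ψ (z + q) - fderiv ℝ ψ (z + q) e₂))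
    + max (-(v z)) 0 * (ε⁻¹ * (ψ (z + q + -e₂) - ψ (z + q) - fderiv ℝ ψ (z + q) (-e₂)))
    - (u (z + q) - u z) * fderiv ℝ ψ (z + q) (1, 0)
    - (v (z + q) - v z) * fderiv ℝ ψ (z + q) (0, 1) with hE
  have cE : Continuous E := by
    simp only [hE]
    fun_prop
  have Eout : ∀ z, z ∉ Metric.closedBall (0 : ℝ × ℝ) (r + R + 1) → E z = 0 := by
    intro z hz
    have h0 := ψout z hz 0 (by simpa using hε.le)
    rw [add_zero] at h0
    simp [hE, ψout z hz e₁ n₁.le, ψout z hz (-e₁) (by rw [norm_neg, n₁]), ψout z hz e₂ n₂.le,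
      ψout z hz (-e₂) (by rw [norm_neg, n₂]), h0, dψout z hz]
  have hdecomp : ∀ z, discreteTransport ε u v g z * ψ (z + q)
      - g z * (u (z + q) * fderiv ℝ ψ (z + q) (1, 0) + v (z + q) * fderiv ℝ ψ (z + q) (0, 1))
      = ε⁻¹ * S z + g z * E z := by
    intro z
    have f₁ : fderiv ℝ ψ (z + q) e₁ = ε * fderiv ℝ ψ (z + q) (1, 0) := by
      rw [← smul_eq_mul, ← map_smul]; simp [he₁]
    have f₂ : fderiv ℝ ψ (z + q) e₂ = ε * fderiv ℝ ψ (z + q) (0, 1) := by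
      rw [← smul_eq_mul, ← map_smul]; simp [he₂]
    have s₁ : z - e₁ = (z.1 - ε, z.2) := by ext <;> simp [he₁]
    have s₂ : z - -e₁ = (z.1 + ε, z.2) := by ext <;> simp [he₁]
    have s₃ : z - e₂ = (z.1, z.2 - ε) := by ext <;> simp [he₂]
    have s₄ : z - -e₂ = (z.1, z.2 + ε) := by ext <;> simp [he₂]
    have hu' := hself (u z)
    have hv' := hself (v z)
    simp only [hS, hE, discreteTransport, map_neg, f₁, f₂, s₁, s₂, s₃, s₄, habs (u z), habs (v z)]
    simp only [ha, hb, hc, hd]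
    generalize max (u z) 0 = up at *
    generalize max (-(u z)) 0 = um at *
    generalize max (v z) 0 = vp at *
    generalize max (-(v z)) 0 = vm at *
    rw [hu', hv']
    field_simp
    ring
  have hbound : ∀ z, |E z| ≤ 2 * M * L * ε + 2 * Λ * D := by
    intro z
    have taylor : ∀ w : ℝ × ℝ, ‖w‖ = ε →
        |ε⁻¹ * (ψ (z + q + w) - ψ (z + q) - fderiv ℝ ψ (z + q) w)| ≤ L * ε := by
      intro w hw
      have h := hL (z + q) w
      rw [hw] at h
      rw [abs_mul, abs_of_pos (inv_pos.2 hε)]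
      calc _ ≤ ε⁻¹ * (L * ε ^ 2) := mul_le_mul_of_nonneg_left h (by positivity)
        _ = L * ε := by field_simp
    have weighted : ∀ p w, |w| ≤ L * ε → |max p 0 * w| ≤ max p 0 * (L * ε) := fun p w hw => by
      rw [abs_mul, abs_of_nonneg (le_max_right p 0)]
      exact mul_le_mul_of_nonneg_left hw (le_max_right p 0)
    have dir : ∀ w : ℝ × ℝ, ‖w‖ = 1 → |fderiv ℝ ψ (z + q) w| ≤ D := fun w hw => by
      have := (fderiv ℝ ψ (z + q)).le_opNorm w
      rw [hw, mul_one] at this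
      exact this.trans (hD _)
    have t₁ := weighted (u z) _ (taylor e₁ n₁)
    have t₂ := weighted (-(u z)) _ (taylor (-e₁) (by rw [norm_neg, n₁]))
    have t₃ := weighted (v z) _ (taylor e₂ n₂)
    have t₄ := weighted (-(v z)) _ (taylor (-e₂) (by rw [norm_neg, n₂]))
    have t₅ : |(u (z + q) - u z) * fderiv ℝ ψ (z + q) (1, 0)| ≤ Λ * D := by
      rw [abs_mul]
      exact mul_le_mul (huΛ z) (dir _ (by simp [Prod.norm_def])) (abs_nonneg _) hΛ0
    have t₆ : |(v (z + q) - v z) * fderiv ℝ ψ (z + q) (0, 1)| ≤ Λ * D := by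
      rw [abs_mul]
      exact mul_le_mul (hvΛ z) (dir _ (by simp [Prod.norm_def])) (abs_nonneg _) hΛ0
    have hu1 : (max (u z) 0 + max (-(u z)) 0) * (L * ε) ≤ M * (L * ε) :=
      mul_le_mul_of_nonneg_right ((habs (u z)).symm.trans_le (huM z)) (by positivity)
    have hv1 : (max (v z) 0 + max (-(v z)) 0) * (L * ε) ≤ M * (L * ε) :=
      mul_le_mul_of_nonneg_right ((habs (v z)).symm.trans_le (hvM z)) (by positivity)
    simp only [hE]
    refine (abs_sub _ _).trans ?_
    refine (add_le_add ((abs_sub _ _).trans (add_le_add ((abs_add_le _ _).trans (add_le_add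
      ((abs_add_le _ _).trans (add_le_add ((abs_add_le _ _).trans (add_le_add t₁ t₂)) t₃)) t₄))
      t₅)) t₆).trans ?_
    linarith
  have igE : Integrable fun z => g z * E z :=
    (hg.mul cE).integrable_of_hasCompactSupport
      (HasCompactSupport.intro cball fun z hz => by simp [Eout z hz])
  simp only [hdecomp]
  rw [integral_add (iS.const_mul _) igE, integral_const_mul, hS0, mul_zero, zero_add,
    ← setIntegral_eq_integral_of_forall_compl_eq_zero
      (s := Metric.closedBall (0 : ℝ × ℝ) (r + R + 1)) (fun z hz => by simp [Eout z hz]),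
    ← integral_const_mul, ← Real.norm_eq_abs]
  have iball : IntegrableOn (fun z => (2 * M * L * ε + 2 * Λ * D) * |g z|)
      (Metric.closedBall 0 (r + R + 1)) :=
    ContinuousOn.integrableOn_compact cball (by fun_prop)
  refine norm_integral_le_of_norm_le iball
    (Filter.Eventually.of_forall fun z => ?_)
  rw [norm_mul, mul_comm]
  exact mul_le_mul_of_nonneg_right (hbound z) (norm_nonneg _)

theorem hasDerivWithinAt_integral_sub_mul {K : ℝ × ℝ → ℝ} (hK : Continuous K)
    (hKc : HasCompactSupport K) (p : ℝ × ℝ) {X : ℝ → BoundedContinuousFunction (ℝ × ℝ) ℝ}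
    {X' : BoundedContinuousFunction (ℝ × ℝ) ℝ} {s : Set ℝ} {t : ℝ}
    (hX : HasDerivWithinAt X X' s t) :
    HasDerivWithinAt (fun r => ∫ q, X r (p - q) * K q) (∫ q, X' (p - q) * K q) s t := by
  have hint : ∀ g : BoundedContinuousFunction (ℝ × ℝ) ℝ, Integrable fun q => g (p - q) * K q :=
    fun g => (show Continuous _ by fun_prop).integrable_of_hasCompactSupport hKc.mul_left
  let T : BoundedContinuousFunction (ℝ × ℝ) ℝ →L[ℝ] ℝ := LinearMap.mkContinuous
    { toFun := fun g => ∫ q, g (p - q) * K q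
      map_add' := fun g g' => by
        simp only [BoundedContinuousFunction.coe_add, Pi.add_apply, add_mul]
        exact integral_add (hint g) (hint g')
      map_smul' := fun c g => by
        simp only [BoundedContinuousFunction.coe_smul, smul_eq_mul, mul_assoc, RingHom.id_apply]
        exact integral_const_mul _ _ }
    (∫ q, ‖K q‖) fun g => by
      rw [mul_comm, ← integral_const_mul]
      refine norm_integral_le_of_norm_le
        ((hK.integrable_of_hasCompactSupport hKc).norm.const_mul _)
        (Filter.Eventually.of_forall fun q => ?_)
      rw [norm_mul]
      exact mul_le_mul_of_nonneg_right (g.norm_coe_le_norm _) (norm_nonneg _)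
  exact (T.hasFDerivAt (x := X t)).comp_hasDerivWithinAt t hX

theorem integral_convolution_residual_eq {K ψ w₁ w₂ g g' : ℝ × ℝ → ℝ} (hK : Continuous K)
    (hKc : HasCompactSupport K) (hψ : Continuous ψ) (hψc : HasCompactSupport ψ)
    (hw₁ : Continuous w₁) (hw₁c : HasCompactSupport w₁)
    (hw₂ : Continuous w₂) (hw₂c : HasCompactSupport w₂) (hg : Continuous g) (hg' : Continuous g') :
    ∫ p, ((∫ q, g' (p - q) * K q) * ψ p - (∫ q, g (p - q) * K q) * w₁ p
      - (∫ q, g (p - q) * K q) * w₂ p)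
    = ∫ q, K q * ∫ z, (g' z * ψ (z + q) - g z * (w₁ (z + q) + w₂ (z + q))) := by
  have hint : ∀ {f : ℝ × ℝ → ℝ}, Continuous f → ∀ (p : ℝ × ℝ) (c : ℝ),
      Integrable fun q => f (p - q) * K q * c := fun hf p c =>
    ((show Continuous _ by fun_prop).integrable_of_hasCompactSupport hKc.mul_left).mul_const c
  have hinner : ∀ p, (∫ q, g' (p - q) * K q) * ψ p - (∫ q, g (p - q) * K q) * w₁ p
      - (∫ q, g (p - q) * K q) * w₂ p
      = ∫ q, (g' (p - q) * K q * ψ p - g (p - q) * K q * w₁ p - g (p - q) * K q * w₂ p) := by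
    intro p
    rw [integral_sub (by exact (hint hg' p _).sub (hint hg p _)) (hint hg p _),
      integral_sub (hint hg' p _) (hint hg p _)]
    simp only [integral_mul_const]
  simp only [hinner]
  rw [integral_integral_swap_of_hasCompactSupport]
  · congr 1
    ext q
    rw [← integral_const_mul, ← integral_add_right_eq_self _ q]
    congr 1
    ext z
    rw [add_sub_cancel_right]
    ring
  · simp only [Function.uncurry_def]
    fun_prop
  · refine HasCompactSupport.intro (((hψc.isCompact.union hw₁c.isCompact).union hw₂c.isCompact).prod
      hKc.isCompact) fun z hz => ?_
    simp only [Function.uncurry_def]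
    by_cases hKz : z.2 ∈ tsupport K
    · have hz1 : z.1 ∉ (tsupport ψ ∪ tsupport w₁) ∪ tsupport w₂ := fun h => hz ⟨h, hKz⟩
      simp only [mem_union, not_or] at hz1
      simp [image_eq_zero_of_notMem_tsupport hz1.1.1, image_eq_zero_of_notMem_tsupport hz1.1.2,
        image_eq_zero_of_notMem_tsupport hz1.2]
    · simp [image_eq_zero_of_notMem_tsupport hKz]

/-- The 2-D family `(u_ε, v_ε, ρ_ε)`, with `ρ_ε = X_ε * φ_{ε^α}` and `X_ε` the solution
of the 2-D discrete transport ODE, is a weak asymptotic method for the continuity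
equation `∂ₜρ + ∂ₓ(ρu) + ∂_y(ρv) = 0`, provided `0 < β < α ≤ 1`. -/
theorem stmt13 (α β : ℝ) (hβ : 0 < β) (hβα : β < α) (hα : α ≤ 1)
    (M₁ : ℝ) (hM₁ : 0 < M₁)
    (u v : ℝ → ℝ → ℝ → ℝ → ℝ) -- `u ε x y t`, `v ε x y t`
    (hu_cont : ∀ ε ∈ Ioo (0:ℝ) 1, ContinuousOn
      (fun p : (ℝ × ℝ) × ℝ => u ε p.1.1 p.1.2 p.2) (univ ×ˢ Ici 0))
    (hv_cont : ∀ ε ∈ Ioo (0:ℝ) 1, ContinuousOn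
      (fun p : (ℝ × ℝ) × ℝ => v ε p.1.1 p.1.2 p.2) (univ ×ˢ Ici 0))
    (hu_per : ∀ ε ∈ Ioo (0:ℝ) 1, ∀ x y : ℝ, ∀ t ∈ Ici (0:ℝ),
      u ε (x + 2*π) y t = u ε x y t ∧ u ε x (y + 2*π) t = u ε x y t)
    (hv_per : ∀ ε ∈ Ioo (0:ℝ) 1, ∀ x y : ℝ, ∀ t ∈ Ici (0:ℝ),
      v ε (x + 2*π) y t = v ε x y t ∧ v ε x (y + 2*π) t = v ε x y t)
    (hu_bdd : ∀ ε ∈ Ioo (0:ℝ) 1, ∀ x y : ℝ, ∀ t ∈ Ici (0:ℝ), |u ε x y t| ≤ M₁)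
    (hv_bdd : ∀ ε ∈ Ioo (0:ℝ) 1, ∀ x y : ℝ, ∀ t ∈ Ici (0:ℝ), |v ε x y t| ≤ M₁)
    (hu_diff : ∀ ε ∈ Ioo (0:ℝ) 1, ∀ t ∈ Ici (0:ℝ),
      Differentiable ℝ (fun p : ℝ × ℝ => u ε p.1 p.2 t) ∧
      Differentiable ℝ (fun p : ℝ × ℝ => v ε p.1 p.2 t))
    (hu_dx : ∀ δ > (0:ℝ), ∃ Cδ > (0:ℝ), ∀ ε ∈ Ioo (0:ℝ) 1, ∀ x y : ℝ, ∀ t ∈ Icc (0:ℝ) δ,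
      |deriv (fun z => u ε z y t) x| ≤ Cδ / ε ^ β ∧
      |deriv (fun z => u ε x z t) y| ≤ Cδ / ε ^ β ∧
      |deriv (fun z => v ε z y t) x| ≤ Cδ / ε ^ β ∧
      |deriv (fun z => v ε x z t) y| ≤ Cδ / ε ^ β)
    (ρ₀ : ℝ → ℝ → ℝ → ℝ) -- `ρ₀ ε x y`
    (hρ₀c : ∀ ε ∈ Ioo (0:ℝ) 1, Continuous fun p : ℝ × ℝ => ρ₀ ε p.1 p.2)
    (hρ₀p : ∀ ε ∈ Ioo (0:ℝ) 1, ∀ x y : ℝ,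
      ρ₀ ε (x + 2*π) y = ρ₀ ε x y ∧ ρ₀ ε x (y + 2*π) = ρ₀ ε x y)
    (C₀ : ℝ)
    (hρ₀i : ∀ ε ∈ Ioo (0:ℝ) 1, (∫ x in (-π)..π, ∫ y in (-π)..π, |ρ₀ ε x y|) ≤ C₀)
    (X : ℝ → ℝ → BoundedContinuousFunction (ℝ × ℝ) ℝ) -- `X ε t`
    (hX0 : ∀ ε ∈ Ioo (0:ℝ) 1, ∀ x y : ℝ, X ε 0 (x, y) = ρ₀ ε x y)
    (hXper : ∀ ε ∈ Ioo (0:ℝ) 1, ∀ t ∈ Ici (0:ℝ), ∀ x y : ℝ,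
      X ε t (x + 2*π, y) = X ε t (x, y) ∧ X ε t (x, y + 2*π) = X ε t (x, y))
    (hX : ∀ ε ∈ Ioo (0:ℝ) 1, ∃ X' : ℝ → BoundedContinuousFunction (ℝ × ℝ) ℝ,
      ContinuousOn X' (Ici 0) ∧
      (∀ t ∈ Ici (0:ℝ), HasDerivWithinAt (X ε) (X' t) (Ici 0) t) ∧
      (∀ t ∈ Ici (0:ℝ), ∀ x y : ℝ,
        X' t (x, y) = ε⁻¹ * (X ε t (x - ε, y) * max (u ε (x - ε) y t) 0
          - X ε t (x, y) * |u ε x y t| + X ε t (x + ε, y) * max (-(u ε (x + ε) y t)) 0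
          + X ε t (x, y - ε) * max (v ε x (y - ε) t) 0
          - X ε t (x, y) * |v ε x y t|
          + X ε t (x, y + ε) * max (-(v ε x (y + ε) t)) 0)))
    (φ : ℝ × ℝ → ℝ) (hφ : ContDiff ℝ (⊤ : ℕ∞) φ) (hφc : HasCompactSupport φ)
    (hφ1 : ∫ p : ℝ × ℝ, φ p = 1)
    (ρ : ℝ → ℝ → ℝ → ℝ → ℝ) -- `ρ ε x y t`, the mollified family
    (hρ : ∀ ε ∈ Ioo (0:ℝ) 1, ∀ x y t : ℝ,
      ρ ε x y t = ∫ q : ℝ × ℝ, X ε t (x - q.1, y - q.2)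
        * (((ε ^ α) ^ 2)⁻¹ * φ (q.1 / ε ^ α, q.2 / ε ^ α)))
    (ψ : ℝ × ℝ → ℝ) (hψ : ContDiff ℝ (⊤ : ℕ∞) ψ) (hψc : HasCompactSupport ψ)
    (δ : ℝ) (hδ : 0 < δ) :
    ∀ η > (0:ℝ), ∃ ε₀ > (0:ℝ), ∀ ε ∈ Ioo (0:ℝ) 1, ε < ε₀ → ∀ t ∈ Icc (0:ℝ) δ,
      |∫ p : ℝ × ℝ, (derivWithin (fun s => ρ ε p.1 p.2 s) (Ici 0) t * ψ p
        - u ε p.1 p.2 t * ρ ε p.1 p.2 t * fderiv ℝ ψ p (1, 0)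
        - v ε p.1 p.2 t * ρ ε p.1 p.2 t * fderiv ℝ ψ p (0, 1))| < η := by
  have hM0 := hM₁.le
  obtain ⟨c, hc0, hc⟩ := hu_dx δ hδ
  obtain ⟨L, hL0, hL⟩ := exists_taylor_bound hψ hψc
  obtain ⟨D, hD⟩ := (hψc.fderiv (𝕜 := ℝ)).exists_bound_of_continuous
    (hψ.continuous_fderiv (by norm_cast))
  obtain ⟨r, hr0, hr⟩ := hψc.isCompact.isBounded.exists_pos_norm_le
  obtain ⟨R, hR0, hR⟩ := hφc.isCompact.isBounded.exists_pos_norm_le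
  have hψr : ∀ z, ψ z ≠ 0 → ‖z‖ ≤ r := fun z hz => hr z (subset_tsupport ψ hz)
  have hψr' : ∀ z, fderiv ℝ ψ z ≠ 0 → ‖z‖ ≤ r := fun z hz => hr z (support_fderiv_subset ℝ hz)
  have hD0 : 0 ≤ D := (norm_nonneg _).trans (hD 0)
  obtain ⟨N, hN0, hN⟩ := setIntegral_closedBall_le_cell (r + R + 1)
  set A : ℝ := ∫ z, ‖φ z‖ with hA
  have hA0 : 0 ≤ A := integral_nonneg fun _ => norm_nonneg _
  have hlim : Filter.Tendsto (fun ε : ℝ =>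
      A * ((2 * M₁ * L * ε + 4 * c * R * D * ε ^ (α - β)) * (N * C₀)))
      (nhdsWithin 0 (Ioi 0)) (nhds 0) := by
    refine Filter.Tendsto.mono_left ?_ nhdsWithin_le_nhds
    have h0 : 0 < α - β := sub_pos.2 hβα
    refine Continuous.tendsto' ?_ _ _ ?_
    · have := Real.continuous_rpow_const (q := α - β) h0.le
      fun_prop
    · simp [Real.zero_rpow h0.ne']
  intro η hη
  obtain ⟨ε₀, hε₀, hsmall⟩ := mem_nhdsGT_iff_exists_Ioo_subset.1
    (hlim.eventually (gt_mem_nhds hη))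
  refine ⟨ε₀, hε₀, fun ε hε hεε₀ t ht => lt_of_le_of_lt ?_ (hsmall ⟨hε.1, hεε₀⟩)⟩
  have hε0 : 0 < ε := hε.1
  obtain ⟨X', -, hXd, hXt⟩ := hX ε hε
  set h : ℝ := ε ^ α with hh
  have hh0 : 0 < h := Real.rpow_pos_of_pos hε0 α
  have hh1 : h ≤ 1 := Real.rpow_le_one hε0.le hε.2.le (hβ.trans hβα).le
  have ht0 : 0 ≤ t := ht.1
  set K : ℝ × ℝ → ℝ := fun q => (h ^ 2)⁻¹ * φ (q.1 / h, q.2 / h) with hKdef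
  have hKsmul : ∀ q : ℝ × ℝ, K q = (h ^ 2)⁻¹ * φ (h⁻¹ • q) := fun q => by
    simp only [hKdef, div_eq_inv_mul]
    rfl
  have hφcont : Continuous φ := hφ.continuous
  have hKcont : Continuous K := by fun_prop
  have hKsupp : ∀ q, K q ≠ 0 → ‖q‖ ≤ R * h := by
    intro q hq
    rw [hKsmul] at hq
    have h1 := hR _ (subset_tsupport φ (right_ne_zero_of_mul hq))
    rwa [norm_smul, norm_inv, Real.norm_eq_abs, abs_of_pos hh0, inv_mul_le_iff₀ hh0,
      mul_comm] at h1
  have hKc : HasCompactSupport K :=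
    HasCompactSupport.intro (isCompact_closedBall (0 : ℝ × ℝ) (R * h)) fun q hq => by
      by_contra hne
      exact hq (mem_closedBall_zero_iff.2 (hKsupp q hne))
  have hKA : ∫ q, ‖K q‖ = A := by
    simp only [hKsmul, norm_mul]
    rw [integral_const_mul, Measure.integral_comp_inv_smul volume (fun q => ‖φ q‖) h]
    have hdim : Module.finrank ℝ (ℝ × ℝ) = 2 := by simp
    rw [hdim, smul_eq_mul, norm_inv, Real.norm_eq_abs, ← mul_assoc,
      inv_mul_cancel₀ (abs_pos.2 (by positivity)).ne', one_mul]
  have hud : ∀ s, 0 ≤ s → Differentiable ℝ (fun p : ℝ × ℝ => u ε p.1 p.2 s) :=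
    fun s hs => (hu_diff ε hε s hs).1
  have hvd : ∀ s, 0 ≤ s → Differentiable ℝ (fun p : ℝ × ℝ => v ε p.1 p.2 s) :=
    fun s hs => (hu_diff ε hε s hs).2
  have hutc := (hud t ht0).continuous
  have hvtc := (hvd t ht0).continuous
  have hdψ : Continuous (fderiv ℝ ψ) := hψ.continuous_fderiv (by norm_cast)
  have hmass : ∫ z in Metric.closedBall 0 (r + R + 1), |X ε t z| ≤ N * C₀ := by
    refine (hN (fun z => |X ε t z|) (by fun_prop) (fun x y => ?_) fun z => abs_nonneg _).trans
      (mul_le_mul_of_nonneg_left ?_ hN0)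
    · simp only [(hXper ε hε t ht0 x y).1, (hXper ε hε t ht0 x y).2, and_self]
    · refine (setIntegral_cell_abs_le_initial hε0
        (u := fun s p => u ε p.1 p.2 s) (v := fun s p => v ε p.1 p.2 s)
        (fun s hs => (hud s hs).continuous) (fun s hs => (hvd s hs).continuous)
        (fun s hs x y => hu_per ε hε x y s hs) (fun s hs x y => hv_per ε hε x y s hs)
        (fun s hs z => hu_bdd ε hε z.1 z.2 s hs) (fun s hs z => hv_bdd ε hε z.1 z.2 s hs)
        (fun s hs x y => hXper ε hε s hs x y) hXd
        (fun s hs z => hXt s hs z.1 z.2) ht0).trans ?_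
      rw [setIntegral_cell_eq_intervalIntegral (g := fun z => |X ε 0 z|) (by fun_prop)]
      simp only [hX0 ε hε]
      exact hρ₀i ε hε
  have hρK : ∀ (p : ℝ × ℝ) s, ρ ε p.1 p.2 s = ∫ q, X ε s (p - q) * K q :=
    fun p s => hρ ε hε p.1 p.2 s
  have hρd : ∀ p : ℝ × ℝ, derivWithin (fun s => ρ ε p.1 p.2 s) (Ici 0) t
      = ∫ q, X' t (p - q) * K q := by
    intro p
    simp only [hρK]
    exact (hasDerivWithinAt_integral_sub_mul hKcont hKc p (hXd t ht0)).derivWithin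
      (uniqueDiffOn_Ici 0 t ht0)
  have hrw : ∀ p : ℝ × ℝ, derivWithin (fun s => ρ ε p.1 p.2 s) (Ici 0) t * ψ p
        - u ε p.1 p.2 t * ρ ε p.1 p.2 t * fderiv ℝ ψ p (1, 0)
        - v ε p.1 p.2 t * ρ ε p.1 p.2 t * fderiv ℝ ψ p (0, 1)
      = (∫ q, X' t (p - q) * K q) * ψ p
        - (∫ q, X ε t (p - q) * K q) * (u ε p.1 p.2 t * fderiv ℝ ψ p (1, 0))
        - (∫ q, X ε t (p - q) * K q) * (v ε p.1 p.2 t * fderiv ℝ ψ p (0, 1)) := by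
    intro p
    rw [hρd, hρK]
    ring
  simp only [hrw]
  rw [integral_convolution_residual_eq hKcont hKc hψ.continuous hψc
    (w₁ := fun p => u ε p.1 p.2 t * fderiv ℝ ψ p (1, 0)) (by fun_prop)
    (HasCompactSupport.mul_left (hψc.fderiv_apply (𝕜 := ℝ) (1, 0)))
    (w₂ := fun p => v ε p.1 p.2 t * fderiv ℝ ψ p (0, 1)) (by fun_prop)
    (HasCompactSupport.mul_left (hψc.fderiv_apply (𝕜 := ℝ) (0, 1)))
    (X ε t).continuous (X' t).continuous, ← hKA, ← integral_mul_const, ← Real.norm_eq_abs]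
  refine norm_integral_le_of_norm_le
    ((hKcont.integrable_of_hasCompactSupport hKc).norm.mul_const _)
    (Filter.Eventually.of_forall fun q => ?_)
  rw [norm_mul]
  by_cases hKq : K q = 0
  · simp [hKq]
  refine mul_le_mul_of_nonneg_left ?_ (norm_nonneg _)
  have hq := hKsupp q hKq
  have hlip : ∀ {f : ℝ × ℝ → ℝ}, Differentiable ℝ f →
      (∀ x y, |deriv (fun s => f (s, y)) x| ≤ c / ε ^ β) →
      (∀ x y, |deriv (fun s => f (x, s)) y| ≤ c / ε ^ β) →
      ∀ z, |f (z + q) - f z| ≤ 2 * (c / ε ^ β) * (R * h) := fun hf hx hy z =>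
    (abs_sub_le_of_abs_partial_deriv_le hf hx hy z q).trans
      (mul_le_mul_of_nonneg_left hq (by positivity))
  have hres := abs_integral_residual_le hε0 hε.2 hutc hvtc
    (fun z => hu_bdd ε hε z.1 z.2 t ht0) (fun z => hv_bdd ε hε z.1 z.2 t ht0)
    (X ε t).continuous hψ hψc hψr hψr' hL0 hL hD
    (hq.trans (mul_le_of_le_one_right hR0.le hh1))
    (hlip (hud t ht0) (fun x y => (hc ε hε x y t ht).1) fun x y => (hc ε hε x y t ht).2.1)
    (hlip (hvd t ht0) (fun x y => (hc ε hε x y t ht).2.2.1) fun x y => (hc ε hε x y t ht).2.2.2)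
  have hX't : ∀ z : ℝ × ℝ, X' t z = discreteTransport ε (fun p => u ε p.1 p.2 t)
      (fun p => v ε p.1 p.2 t) (X ε t) z := fun z => hXt t ht0 z.1 z.2
  simp only [hX't]
  refine hres.trans ?_
  have hconst : 2 * M₁ * L * ε + 2 * (2 * (c / ε ^ β) * (R * h)) * D
      = 2 * M₁ * L * ε + 4 * c * R * D * ε ^ (α - β) := by
    rw [Real.rpow_sub hε0]
    ring
  rw [hconst]
  exact mul_le_mul_of_nonneg_left hmass (by positivity)
end

section
/- Let ε > 0, M > 0, T ∈ (0,∞], and let F : ℝ × [0,T) → ℝ be continuous with |F(x,t)| ≤ M for all x, t. Let u : [0,T) → C_b(ℝ) be a continuously differentiable curve satisfying ∂ₜu(x,t) = (1/ε)[u(x−ε,t)F(x−ε,t)⁺ − u(x,t)|F(x,t)| + u(x+ε,t)F(x+ε,t)⁻] for all x ∈ ℝ and t ∈ [0,T). Then for all t ∈ [0,T), ‖u(·,t)‖_∞ ≤ ‖u(·,0)‖_∞ · exp(3Mt/ε). -/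
open MeasureTheory Set Real ENNReal

/-- The discrete transport operator with step `ε` and coefficient bounded by `M` has sup-norm
at most `3 * M / ε`. -/
theorem abs_discreteTransport_le {ε M C : ℝ} (hε : 0 < ε) {f v : ℝ → ℝ}
    (hf : ∀ x, |f x| ≤ M) (hv : ∀ x, |v x| ≤ C) (x : ℝ) :
    |ε⁻¹ * (v (x - ε) * max (f (x - ε)) 0 - v x * |f x|
      + v (x + ε) * max (-(f (x + ε))) 0)| ≤ 3 * M / ε * C := by
  have hC : 0 ≤ C := (abs_nonneg _).trans (hv x)
  have hM : 0 ≤ M := (abs_nonneg _).trans (hf x)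
  have hmul : ∀ y b, |b| ≤ M → |v y * b| ≤ C * M := fun y b hb => by
    rw [abs_mul]
    exact mul_le_mul (hv y) hb (abs_nonneg _) hC
  have hpos := hmul (x - ε) (max (f (x - ε)) 0) <| by
    rw [abs_of_nonneg (le_max_right _ _)]
    exact max_le ((le_abs_self _).trans (hf _)) hM
  have hmid := hmul x |f x| (by rw [abs_abs]; exact hf x)
  have hneg := hmul (x + ε) (max (-(f (x + ε))) 0) <| by
    rw [abs_of_nonneg (le_max_right _ _)]
    exact max_le ((neg_le_abs _).trans (hf _)) hM
  rw [abs_mul, abs_of_pos (inv_pos.2 hε),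
    show 3 * M / ε * C = ε⁻¹ * (3 * (C * M)) by ring]
  gcongr
  rw [abs_le] at *
  constructor <;> linarith

/-- Gronwall-type bound: a solution `u : [0,T) → C_b(ℝ)` of the discrete transport ODE
with step `ε` and bounded coefficient `|F| ≤ M` satisfies
`‖u(·,t)‖_∞ ≤ ‖u(·,0)‖_∞ · exp(3Mt/ε)`.  Here `T ∈ (0,∞]` and `[0,T)` is encoded as
`{t : ℝ | 0 ≤ t ∧ ENNReal.ofReal t < T}`. -/
theorem stmt14 (ε M : ℝ) (hε : 0 < ε) (hM : 0 < M)
    (T : ℝ≥0∞) (hT : 0 < T)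
    (F : ℝ → ℝ → ℝ) -- `F x t`
    (hF_cont : ContinuousOn (fun p : ℝ × ℝ => F p.1 p.2)
      (univ ×ˢ {t : ℝ | 0 ≤ t ∧ ENNReal.ofReal t < T}))
    (hF_bdd : ∀ x : ℝ, ∀ t ∈ {t : ℝ | 0 ≤ t ∧ ENNReal.ofReal t < T}, |F x t| ≤ M)
    (u : ℝ → BoundedContinuousFunction ℝ ℝ)
    (hu : ∃ u' : ℝ → BoundedContinuousFunction ℝ ℝ,
      ContinuousOn u' {t : ℝ | 0 ≤ t ∧ ENNReal.ofReal t < T} ∧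
      (∀ t ∈ {t : ℝ | 0 ≤ t ∧ ENNReal.ofReal t < T},
        HasDerivWithinAt u (u' t) {t : ℝ | 0 ≤ t ∧ ENNReal.ofReal t < T} t) ∧
      (∀ t ∈ {t : ℝ | 0 ≤ t ∧ ENNReal.ofReal t < T}, ∀ x : ℝ,
        u' t x = ε⁻¹ * (u t (x - ε) * max (F (x - ε) t) 0
          - u t x * |F x t| + u t (x + ε) * max (-(F (x + ε) t)) 0))) :
    ∀ t ∈ {t : ℝ | 0 ≤ t ∧ ENNReal.ofReal t < T},
      ‖u t‖ ≤ ‖u 0‖ * Real.exp (3 * M * t / ε) := by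
  obtain ⟨u', -, hderiv, heq⟩ := hu
  rintro t ⟨ht0, htT⟩
  have hsub : Icc 0 t ⊆ {t : ℝ | 0 ≤ t ∧ ENNReal.ofReal t < T} := fun s hs =>
    ⟨hs.1, (ENNReal.ofReal_le_ofReal hs.2).trans_lt htT⟩
  have hnorm : ∀ s ∈ Ico 0 t, ‖u' s‖ ≤ 3 * M / ε * ‖u s‖ + 0 := by
    intro s hs
    have hs' := hsub (Ico_subset_Icc_self hs)
    rw [add_zero, BoundedContinuousFunction.norm_le (by positivity)]
    intro x
    rw [heq s hs' x]
    exact abs_discreteTransport_le hε (fun y => hF_bdd y s hs') (u s).norm_coe_le_norm x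
  have hgronwall := norm_le_gronwallBound_of_norm_deriv_right_le (f := u) (f' := u')
    (δ := ‖u 0‖) (K := 3 * M / ε) (ε := 0) (a := 0) (b := t)
    (fun s hs => ((hderiv s (hsub hs)).mono hsub).continuousWithinAt)
    (fun s hs => ((hderiv s (hsub (Ico_subset_Icc_self hs))).mono
      ((Icc_subset_Icc_left hs.1).trans hsub)).mono_of_mem_nhdsWithin (Icc_mem_nhdsGE hs.2))
    le_rfl hnorm t ⟨ht0, le_rfl⟩
  rwa [gronwallBound_ε0, sub_zero, div_mul_eq_mul_div] at hgronwall
end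

section
/- Let f, g : ℝ² → ℝ be real-analytic and bounded on ℝ². Then for every ε > 0 and all initial data u₀, v₀ ∈ C_b(ℝ) there exists a continuously differentiable curve (u,v) : [0,∞) → C_b(ℝ) × C_b(ℝ) with u(·,0) = u₀, v(·,0) = v₀, satisfying for all x ∈ ℝ and t ≥ 0: ∂ₜu(x,t) = (1/ε)[u(x−ε,t)f^{+}(x−ε,t) − u(x,t)|f̃(x,t)| + u(x+ε,t)f^{−}(x+ε,t)] and ∂ₜv(x,t) = (1/ε)[v(x−ε,t)g^{+}(x−ε,t) − v(x,t)|g̃(x,t)| + v(x+ε,t)g^{−}(x+ε,t)], where f̃(x,t) = f(u(x,t),v(x,t)) and g̃(x,t) = g(u(x,t),v(x,t)), and f^{±}, g^{±} denote the positive and negative parts of f̃ and g̃. -/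
open MeasureTheory Set Real

open NNReal Metric in
/-- A vector field on a Banach space which is globally Lipschitz and bounded has solutions on every
compact interval. -/
lemma exists_solution_Icc_of_lipschitz_of_bounded {E : Type*} [NormedAddCommGroup E]
    [NormedSpace ℝ E] [CompleteSpace E] {G : E → E} {K B : ℝ≥0} (hG : LipschitzWith K G)
    (hB : ∀ w, ‖G w‖ ≤ B) (w₀ : E) {T : ℝ} (hT : 0 ≤ T) :
    ∃ w : ℝ → E, w 0 = w₀ ∧ ∀ t ∈ Icc 0 T, HasDerivWithinAt w (G (w t)) (Icc 0 T) t := by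
  have hP : IsPicardLindelof (fun _ : ℝ ↦ G) (⟨0, left_mem_Icc.2 hT⟩ : Icc 0 T) w₀
      (B * T.toNNReal) 0 B K :=
    { lipschitzOnWith := fun _ _ ↦ hG.lipschitzOnWith
      continuousOn := fun _ _ ↦ continuousOn_const
      norm_le := fun _ _ w _ ↦ hB w
      mul_max_le := by simp [hT] }
  exact hP.exists_eq_forall_mem_Icc_hasDerivWithinAt₀

/-- Grönwall bound for solutions of a differential equation of linear growth. -/
lemma norm_le_mul_exp_of_hasDerivWithinAt {E : Type*} [NormedAddCommGroup E] [NormedSpace ℝ E]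
    {G : E → E} {C : ℝ} (hC : ∀ w, ‖G w‖ ≤ C * ‖w‖) {w : ℝ → E} {T : ℝ}
    (hw : ∀ t ∈ Icc 0 T, HasDerivWithinAt w (G (w t)) (Icc 0 T) t) {t : ℝ} (ht : t ∈ Icc 0 T) :
    ‖w t‖ ≤ ‖w 0‖ * exp (C * t) := by
  have := norm_le_gronwallBound_of_norm_deriv_right_le (f := w) (f' := fun t ↦ G (w t))
    (δ := ‖w 0‖) (K := C) (ε := 0) (a := 0) (b := T)
    (fun t ht ↦ (hw t ht).continuousWithinAt)
    (fun t ht ↦ (hw t (Ico_subset_Icc_self ht)).mono_of_mem_nhdsWithin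
      (Icc_mem_nhdsGE_of_mem ht)) le_rfl (fun t _ ↦ by simpa using hC (w t)) t ht
  simpa [gronwallBound_ε0] using this

open NNReal Metric in
/-- Global existence for a vector field `F` of linear growth that coincides on each ball
`closedBall 0 n` with a bounded, globally Lipschitz vector field of the same linear growth. -/
lemma exists_global_solution_of_truncations {E : Type*} [NormedAddCommGroup E]
    [NormedSpace ℝ E] [CompleteSpace E] {F : E → E} {G : ℕ → E → E} {C : ℝ} (hC₀ : 0 ≤ C)
    (hG : ∀ n, ∃ K, LipschitzWith K (G n)) (hB : ∀ n, ∃ B : ℝ≥0, ∀ w, ‖G n w‖ ≤ B)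
    (hC : ∀ n w, ‖G n w‖ ≤ C * ‖w‖) (hF : ∀ (n : ℕ) w, ‖w‖ ≤ n → G n w = F w) (w₀ : E) :
    ∃ w : ℝ → E, w 0 = w₀ ∧ ContinuousOn (fun t ↦ F (w t)) (Ici 0) ∧
      ∀ t ∈ Ici (0 : ℝ), HasDerivWithinAt w (F (w t)) (Ici 0) t := by
  choose K hK using hG
  choose B hB using hB
  have hFcont : Continuous F := by
    refine continuous_iff_continuousAt.2 fun w ↦ ?_
    obtain ⟨n, hn⟩ := exists_nat_gt ‖w‖
    refine ((hK n).continuous.continuousAt (x := w)).congr ?_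
    filter_upwards [continuous_norm.continuousAt.eventually_lt continuousAt_const hn] with z hz
    exact hF n z hz.le
  have key : ∀ m : ℕ, ∃ w : ℝ → E, w 0 = w₀ ∧
      (∀ t ∈ Icc (0 : ℝ) m, HasDerivWithinAt w (F (w t)) (Icc 0 m) t) ∧
      ∀ t ∈ Icc (0 : ℝ) m, ‖w t‖ ≤ ‖w₀‖ * exp (C * t) := by
    intro m
    obtain ⟨n, hn⟩ := exists_nat_ge (‖w₀‖ * exp (C * m))
    obtain ⟨w, hw0, hw⟩ :=
      exists_solution_Icc_of_lipschitz_of_bounded (hK n) (hB n) w₀ m.cast_nonneg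
    have hbd : ∀ t ∈ Icc (0 : ℝ) m, ‖w t‖ ≤ ‖w₀‖ * exp (C * t) := fun t ht ↦
      hw0 ▸ norm_le_mul_exp_of_hasDerivWithinAt (hC n) hw ht
    refine ⟨w, hw0, fun t ht ↦ ?_, hbd⟩
    rw [← hF n (w t) ((hbd t ht).trans (le_trans (by have := ht.2; gcongr) hn))]
    exact hw t ht
  choose w hw0 hw hbd using key
  have huniq : ∀ {m k : ℕ}, m ≤ k → EqOn (w m) (w k) (Icc 0 m) := by
    intro m k hmk
    have hmk' : (m : ℝ) ≤ k := by exact_mod_cast hmk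
    obtain ⟨n, hn⟩ := exists_nat_ge (‖w₀‖ * exp (C * k))
    have hlip : LipschitzOnWith (K n) F (closedBall 0 n) := fun x hx y hy ↦ by
      rw [← hF n x (by simpa using hx), ← hF n y (by simpa using hy)]
      exact hK n x y
    have hmem : ∀ j : ℕ, m ≤ j → j ≤ k → ∀ t ∈ Ico (0 : ℝ) m, w j t ∈ closedBall (0 : E) n := by
      intro j hmj hjk t ht
      have hmj' : (m : ℝ) ≤ j := by exact_mod_cast hmj
      have htk : t ≤ k := ht.2.le.trans hmk'
      rw [mem_closedBall_zero_iff]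
      exact (hbd j t ⟨ht.1, ht.2.le.trans hmj'⟩).trans (le_trans (by gcongr) hn)
    have hcont : ∀ j : ℕ, m ≤ j → ContinuousOn (w j) (Icc 0 m) := fun j hmj t ht ↦
      (hw j t ⟨ht.1, ht.2.trans (by exact_mod_cast hmj)⟩).continuousWithinAt.mono
        (Icc_subset_Icc_right (by exact_mod_cast hmj))
    have hder : ∀ j : ℕ, m ≤ j → ∀ t ∈ Ico (0 : ℝ) m,
        HasDerivWithinAt (w j) (F (w j t)) (Ici t) t := by
      intro j hmj t ht
      have hmj' : (m : ℝ) ≤ j := by exact_mod_cast hmj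
      exact (hw j t ⟨ht.1, ht.2.le.trans hmj'⟩).mono_of_mem_nhdsWithin
        (Icc_mem_nhdsGE_of_mem ⟨ht.1, ht.2.trans_le hmj'⟩)
    exact ODE_solution_unique_of_mem_Icc_right (v := fun _ ↦ F) (s := fun _ ↦ closedBall 0 n)
      (fun _ _ ↦ hlip) (hcont m le_rfl) (hder m le_rfl) (hmem m le_rfl hmk)
      (hcont k hmk) (hder k hmk) (hmem k hmk le_rfl) (by rw [hw0, hw0])
  let z : ℝ → E := fun t ↦ w ⌈t⌉₊ t
  have hz : ∀ m : ℕ, EqOn z (w m) (Icc 0 m) := fun m t ht ↦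
    huniq (Nat.ceil_le.2 ht.2) ⟨ht.1, Nat.le_ceil t⟩
  have hder : ∀ t ∈ Ici (0 : ℝ), HasDerivWithinAt z (F (z t)) (Ici 0) t := by
    intro t ht
    obtain ⟨m, hm⟩ := exists_nat_gt t
    have htm : t ∈ Icc (0 : ℝ) m := ⟨ht, hm.le⟩
    rw [hz m htm]
    refine ((hw m t htm).congr (hz m) (hz m htm)).mono_of_mem_nhdsWithin ?_
    rw [← Ici_inter_Iic]
    exact Filter.inter_mem self_mem_nhdsWithin (mem_nhdsWithin_of_mem_nhds (Iic_mem_nhds hm))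
  exact ⟨z, by simp [z, hw0],
    hFcont.comp_continuousOn fun t ht ↦ (hder t ht).continuousWithinAt, hder⟩

/-- Projection of the plane onto the square `[-r, r]²`. -/
def clampSquare (r : ℝ) (p : ℝ × ℝ) : ℝ × ℝ :=
  (max (-r) (min p.1 r), max (-r) (min p.2 r))

lemma lipschitzWith_clampSquare (r : ℝ) : LipschitzWith 1 (clampSquare r) := by
  simpa using! ((LipschitzWith.prod_fst.min_const r).const_max (-r)).prodMk
    ((LipschitzWith.prod_snd.min_const r).const_max (-r))

lemma norm_clampSquare_le {r : ℝ} (hr : 0 ≤ r) (p : ℝ × ℝ) : ‖clampSquare r p‖ ≤ r := by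
  simp only [clampSquare, Prod.norm_def, Real.norm_eq_abs]
  grind

lemma norm_clampSquare_le_norm {r : ℝ} (hr : 0 ≤ r) (p : ℝ × ℝ) : ‖clampSquare r p‖ ≤ ‖p‖ := by
  simp only [clampSquare, Prod.norm_def, Real.norm_eq_abs]
  exact max_le_max (by grind) (by grind)

lemma clampSquare_of_norm_le {r : ℝ} {p : ℝ × ℝ} (hp : ‖p‖ ≤ r) : clampSquare r p = p := by
  rw [Prod.norm_def, max_le_iff, Real.norm_eq_abs, Real.norm_eq_abs, abs_le, abs_le] at hp
  simp [clampSquare, hp]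

lemma LocallyLipschitz.exists_lipschitzWith_comp_clampSquare {A : ℝ × ℝ → ℝ × ℝ}
    (hA : LocallyLipschitz A) {r : ℝ} (hr : 0 ≤ r) :
    ∃ K, LipschitzWith K (A ∘ clampSquare r) := by
  obtain ⟨K, hK⟩ := hA.locallyLipschitzOn.exists_lipschitzOnWith_of_compact
    (isCompact_closedBall (0 : ℝ × ℝ) r)
  refine ⟨K * 1, ?_⟩
  rw [← lipschitzOnWith_univ]
  exact hK.comp (lipschitzWith_clampSquare r).lipschitzOnWith
    fun p _ ↦ by simpa using norm_clampSquare_le hr p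

open BoundedContinuousFunction NNReal in
/-- Global existence for `∂ₜw(x) = c (A(w(x - ε)) - B(w(x)) + D(w(x + ε)))` in `C_b(ℝ; ℝ²)`, for
locally Lipschitz nonlinearities of linear growth. -/
lemma exists_global_solution_discrete_transport {A B D : ℝ × ℝ → ℝ × ℝ}
    (hA : LocallyLipschitz A) (hB : LocallyLipschitz B) (hD : LocallyLipschitz D)
    {M : ℝ} (hM : 0 ≤ M) (hAM : ∀ p, ‖A p‖ ≤ M * ‖p‖) (hBM : ∀ p, ‖B p‖ ≤ M * ‖p‖)
    (hDM : ∀ p, ‖D p‖ ≤ M * ‖p‖) (c ε : ℝ) (w₀ : ℝ →ᵇ ℝ × ℝ) :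
    ∃ w w' : ℝ → ℝ →ᵇ ℝ × ℝ, w 0 = w₀ ∧ ContinuousOn w' (Ici 0) ∧
      (∀ t ∈ Ici (0 : ℝ), HasDerivWithinAt w (w' t) (Ici 0) t) ∧
      ∀ t x, w' t x = c • (A (w t (x - ε)) - B (w t x) + D (w t (x + ε))) := by
  choose KA hKA using fun n : ℕ ↦ hA.exists_lipschitzWith_comp_clampSquare n.cast_nonneg
  choose KB hKB using fun n : ℕ ↦ hB.exists_lipschitzWith_comp_clampSquare n.cast_nonneg
  choose KD hKD using fun n : ℕ ↦ hD.exists_lipschitzWith_comp_clampSquare n.cast_nonneg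
  let σ : C(ℝ, ℝ) := ⟨fun x ↦ x - ε, by fun_prop⟩
  let τ : C(ℝ, ℝ) := ⟨fun x ↦ x + ε, by fun_prop⟩
  let G : ℕ → (ℝ →ᵇ ℝ × ℝ) → (ℝ →ᵇ ℝ × ℝ) := fun n w ↦
    c • ((w.comp _ (hKA n)).compContinuous σ - w.comp _ (hKB n)
      + (w.comp _ (hKD n)).compContinuous τ)
  have hGx : ∀ n w x, G n w x = c • (A (clampSquare n (w (x - ε))) - B (clampSquare n (w x))
      + D (clampSquare n (w (x + ε)))) := fun _ _ _ ↦ rfl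
  have hGw : ∀ (n : ℕ) w, ‖w‖ ≤ n → ∀ x,
      G n w x = c • (A (w (x - ε)) - B (w x) + D (w (x + ε))) := by
    intro n w hw x
    have h : ∀ y, clampSquare n (w y) = w y := fun y ↦
      clampSquare_of_norm_le ((w.norm_coe_le_norm y).trans hw)
    rw [hGx, h, h, h]
  have hF : ∀ w : ℝ →ᵇ ℝ × ℝ, ∃ z : ℝ →ᵇ ℝ × ℝ, ∀ x,
      z x = c • (A (w (x - ε)) - B (w x) + D (w (x + ε))) := fun w ↦
    ⟨G ⌈‖w‖⌉₊ w, hGw _ w (Nat.le_ceil _)⟩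
  choose F hF using hF
  have hGnorm : ∀ (n : ℕ) (w : ℝ →ᵇ ℝ × ℝ) (R : ℝ), 0 ≤ R →
      (∀ x, ‖clampSquare n (w x)‖ ≤ R) → ‖G n w‖ ≤ |c| * (3 * M) * R := by
    intro n w R hR h
    refine (norm_le (by positivity)).2 fun x ↦ ?_
    rw [hGx, norm_smul, Real.norm_eq_abs, mul_assoc]
    refine mul_le_mul_of_nonneg_left ?_ (abs_nonneg c)
    have h₁ := (hAM _).trans (mul_le_mul_of_nonneg_left (h (x - ε)) hM)
    have h₂ := (hBM _).trans (mul_le_mul_of_nonneg_left (h x) hM)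
    have h₃ := (hDM _).trans (mul_le_mul_of_nonneg_left (h (x + ε)) hM)
    have h₄ := norm_sub_le (A (clampSquare n (w (x - ε)))) (B (clampSquare n (w x)))
    exact (norm_add_le _ _).trans (by linarith)
  obtain ⟨w, hw0, hcont, hder⟩ := exists_global_solution_of_truncations (F := F) (G := G)
    (C := |c| * (3 * M)) (by positivity)
    (fun n ↦ ⟨_, (lipschitzWith_smul c).comp
      ((((lipschitz_compContinuous σ).comp (lipschitz_comp (hKA n))).sub
        (lipschitz_comp (hKB n))).add
        ((lipschitz_compContinuous τ).comp (lipschitz_comp (hKD n))))⟩)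
    (fun n ↦ ⟨⟨|c| * (3 * M) * n, by positivity⟩, fun w ↦
      hGnorm n w n n.cast_nonneg fun x ↦ norm_clampSquare_le n.cast_nonneg _⟩)
    (fun n w ↦ hGnorm n w ‖w‖ (norm_nonneg w) fun x ↦
      (norm_clampSquare_le_norm n.cast_nonneg _).trans (w.norm_coe_le_norm x))
    (fun n w hw ↦ by ext1 x; rw [hGw n w hw, hF]) w₀
  exact ⟨w, fun t ↦ F (w t), hw0, hcont, hder, fun t x ↦ hF (w t) x⟩

/-- The pair `(u a(u,v), v b(u,v))` is locally Lipschitz in `(u,v)` when `a` and `b` are. -/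
lemma LocallyLipschitz.prodMk_fst_mul_snd_mul {a b : ℝ × ℝ → ℝ} (ha : LocallyLipschitz a)
    (hb : LocallyLipschitz b) :
    LocallyLipschitz fun p : ℝ × ℝ ↦ (p.1 * a p, p.2 * b p) := by
  have hmul : LocallyLipschitz fun q : ℝ × ℝ ↦ q.1 * q.2 :=
    (contDiff_fst.mul contDiff_snd : ContDiff ℝ 1 _).locallyLipschitz
  exact (hmul.comp (LipschitzWith.prod_fst.locallyLipschitz.prodMk ha)).prodMk
    (hmul.comp (LipschitzWith.prod_snd.locallyLipschitz.prodMk hb))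

lemma norm_prodMk_fst_mul_snd_mul_le {a b : ℝ × ℝ → ℝ} {M : ℝ} (ha : ∀ p, |a p| ≤ M)
    (hb : ∀ p, |b p| ≤ M) (p : ℝ × ℝ) : ‖(p.1 * a p, p.2 * b p)‖ ≤ M * ‖p‖ := by
  have hM : 0 ≤ M := (abs_nonneg _).trans (ha p)
  refine max_le ?_ ?_
  · rw [norm_mul, mul_comm]
    exact mul_le_mul (ha p) (norm_fst_le p) (norm_nonneg _) hM
  · rw [norm_mul, mul_comm]
    exact mul_le_mul (hb p) (norm_snd_le p) (norm_nonneg _) hM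

/-- Global existence for the coupled nonlinear discrete transport system: if `f, g` are
real-analytic and bounded on `ℝ²`, then for every `ε > 0` and all initial data
`u₀, v₀ ∈ C_b(ℝ)` there is a continuously differentiable curve
`(u,v) : [0,∞) → C_b(ℝ) × C_b(ℝ)` solving the system with velocities
`f̃ = f(u,v)`, `g̃ = g(u,v)`. -/
theorem stmt15 (f g : ℝ × ℝ → ℝ)
    (hf : AnalyticOnNhd ℝ f univ) (hg : AnalyticOnNhd ℝ g univ)
    (hf_bdd : ∃ M : ℝ, ∀ p : ℝ × ℝ, |f p| ≤ M)
    (hg_bdd : ∃ M : ℝ, ∀ p : ℝ × ℝ, |g p| ≤ M)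
    (ε : ℝ) (hε : 0 < ε)
    (u₀ v₀ : BoundedContinuousFunction ℝ ℝ) :
    ∃ u v : ℝ → BoundedContinuousFunction ℝ ℝ,
      u 0 = u₀ ∧ v 0 = v₀ ∧
      ∃ u' v' : ℝ → BoundedContinuousFunction ℝ ℝ,
        ContinuousOn u' (Ici 0) ∧ ContinuousOn v' (Ici 0) ∧
        (∀ t ∈ Ici (0:ℝ), HasDerivWithinAt u (u' t) (Ici 0) t) ∧
        (∀ t ∈ Ici (0:ℝ), HasDerivWithinAt v (v' t) (Ici 0) t) ∧
        (∀ t ∈ Ici (0:ℝ), ∀ x : ℝ,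
          u' t x = ε⁻¹ * (u t (x - ε) * max (f (u t (x - ε), v t (x - ε))) 0
            - u t x * |f (u t x, v t x)|
            + u t (x + ε) * max (-(f (u t (x + ε), v t (x + ε)))) 0)) ∧
        (∀ t ∈ Ici (0:ℝ), ∀ x : ℝ,
          v' t x = ε⁻¹ * (v t (x - ε) * max (g (u t (x - ε), v t (x - ε))) 0
            - v t x * |g (u t x, v t x)|
            + v t (x + ε) * max (-(g (u t (x + ε), v t (x + ε)))) 0)) := by
  obtain ⟨Mf, hMf⟩ := hf_bdd
  obtain ⟨Mg, hMg⟩ := hg_bdd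
  have hfM : ∀ p, |f p| ≤ max Mf Mg := fun p ↦ (hMf p).trans (le_max_left _ _)
  have hgM : ∀ p, |g p| ≤ max Mf Mg := fun p ↦ (hMg p).trans (le_max_right _ _)
  have hfL : LocallyLipschitz f := hf.contDiff.locallyLipschitz
  have hgL : LocallyLipschitz g := hg.contDiff.locallyLipschitz
  have habs : LocallyLipschitz fun r : ℝ ↦ |r| := lipschitzWith_one_norm.locallyLipschitz
  have hpos : ∀ r : ℝ, |max r 0| ≤ |r| := fun r ↦ by grind
  have hneg : ∀ r : ℝ, |max (-r) 0| ≤ |r| := fun r ↦ by grind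
  let w₀ : BoundedContinuousFunction ℝ (ℝ × ℝ) :=
    .ofNormedAddCommGroup (fun x ↦ (u₀ x, v₀ x)) (by fun_prop) (max ‖u₀‖ ‖v₀‖)
      fun x ↦ max_le_max (u₀.norm_coe_le_norm x) (v₀.norm_coe_le_norm x)
  obtain ⟨w, w', hw0, hcont, hder, hw'⟩ := exists_global_solution_discrete_transport
    ((hfL.max_const 0).prodMk_fst_mul_snd_mul (hgL.max_const 0))
    ((habs.comp hfL).prodMk_fst_mul_snd_mul (habs.comp hgL))
    ((hfL.neg.max_const 0).prodMk_fst_mul_snd_mul (hgL.neg.max_const 0))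
    ((abs_nonneg _).trans (hfM 0))
    (norm_prodMk_fst_mul_snd_mul_le (fun p ↦ (hpos _).trans (hfM p))
      fun p ↦ (hpos _).trans (hgM p))
    (norm_prodMk_fst_mul_snd_mul_le (fun p ↦ (abs_abs _).trans_le (hfM p))
      fun p ↦ (abs_abs _).trans_le (hgM p))
    (norm_prodMk_fst_mul_snd_mul_le (fun p ↦ (hneg _).trans (hfM p))
      fun p ↦ (hneg _).trans (hgM p)) ε⁻¹ ε w₀
  let P₁ := (ContinuousLinearMap.fst ℝ ℝ ℝ).compLeftContinuousBounded ℝ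
  let P₂ := (ContinuousLinearMap.snd ℝ ℝ ℝ).compLeftContinuousBounded ℝ
  refine ⟨fun t ↦ P₁ (w t), fun t ↦ P₂ (w t), by ext x; simp [P₁, hw0, w₀],
    by ext x; simp [P₂, hw0, w₀], fun t ↦ P₁ (w' t), fun t ↦ P₂ (w' t),
    P₁.continuous.comp_continuousOn hcont, P₂.continuous.comp_continuousOn hcont,
    fun t ht ↦ P₁.hasFDerivAt.comp_hasDerivWithinAt t (hder t ht),
    fun t ht ↦ P₂.hasFDerivAt.comp_hasDerivWithinAt t (hder t ht), fun t _ x ↦ ?_, fun t _ x ↦ ?_⟩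
  · simpa [P₁, P₂] using congrArg Prod.fst (hw' t x)
  · simpa [P₁, P₂] using congrArg Prod.snd (hw' t x)
end

section
/- Let ε > 0, let f, g : ℝ² → ℝ be continuous and bounded, and let (u,v) : [0,∞) → C_b(ℝ) × C_b(ℝ) be a continuously differentiable curve satisfying ∂ₜu(x,t) = (1/ε)[u(x−ε,t)f̃(x−ε,t)⁺ − u(x,t)|f̃(x,t)| + u(x+ε,t)f̃(x+ε,t)⁻] and the analogous equation for v with g̃, where f̃(x,t) = f(u(x,t),v(x,t)) and g̃(x,t) = g(u(x,t),v(x,t)). If u(·,0) and v(·,0) are 2π-periodic and u(·,t), v(·,t) are 2π-periodic for all t, then for all t ≥ 0, ∫₀^{2π}|u(x,t)|dx ≤ ∫₀^{2π}|u(x,0)|dx. -/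
open MeasureTheory Set Real

/-- The `L¹`-norm over `[0, 2π]` is dominated, up to the factor `2π`, by the sup norm. -/
lemma integral_abs_le_add_norm_sub (a b : BoundedContinuousFunction ℝ ℝ) :
    (∫ x in (0:ℝ)..(2*π), |a x|) ≤ (∫ x in (0:ℝ)..(2*π), |b x|) + 2 * π * ‖a - b‖ := by
  have hpi : (0:ℝ) ≤ 2 * π := by positivity
  have h : (∫ x in (0:ℝ)..(2*π), |a x|) ≤ ∫ x in (0:ℝ)..(2*π), (|b x| + ‖a - b‖) := by
    refine intervalIntegral.integral_mono_on hpi (a.continuous.abs.intervalIntegrable _ _)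
      ((b.continuous.abs.add continuous_const).intervalIntegrable _ _) fun x _ => ?_
    have h1 : |a x - b x| ≤ ‖a - b‖ := by simpa using (a - b).norm_coe_le_norm x
    linarith [abs_sub_abs_le_abs_sub (a x) (b x)]
  rw [intervalIntegral.integral_add (b.continuous.abs.intervalIntegrable _ _)
    (continuous_const.intervalIntegrable _ _)] at h
  simpa using h

lemma integral_periodic_comp_add {w : ℝ → ℝ} {T : ℝ} (hw : Function.Periodic w T) (c : ℝ) :
    (∫ x in (0:ℝ)..T, w (x + c)) = ∫ x in (0:ℝ)..T, w x := by
  rw [intervalIntegral.integral_comp_add_right, zero_add, add_comm T c]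
  simpa using hw.intervalIntegral_add_eq c 0

/-- One explicit Euler step of the upwind scheme with periodic coefficients does not increase the
`L¹`-norm, provided the step satisfies the CFL condition `k * |F x| ≤ 1`. -/
lemma integral_abs_upwind_step_le {w F : ℝ → ℝ} {T k : ℝ} (ε : ℝ) (hT : 0 ≤ T)
    (hw : Continuous w) (hF : Continuous F)
    (hwT : Function.Periodic w T) (hFT : Function.Periodic F T)
    (hk : 0 ≤ k) (hkF : ∀ x, k * |F x| ≤ 1) :
    (∫ x in (0:ℝ)..T, |w x + k * (w (x - ε) * max (F (x - ε)) 0 - w x * |F x|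
      + w (x + ε) * max (-F (x + ε)) 0)|) ≤ ∫ x in (0:ℝ)..T, |w x| := by
  set p : ℝ → ℝ := fun x => k * (|w x| * max (F x) 0) with hp
  set q : ℝ → ℝ := fun x => k * (|w x| * max (-F x) 0) with hq
  have hpc : Continuous p := by fun_prop
  have hqc : Continuous q := by fun_prop
  have hpT : Function.Periodic p T := fun x => by simp only [hp, hwT x, hFT x]
  have hqT : Function.Periodic q T := fun x => by simp only [hq, hwT x, hFT x]
  have hpq : ∀ x, p x + q x = k * (|w x| * |F x|) := fun x => by
    have : max (F x) 0 + max (-F x) 0 = |F x| := by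
      rcases le_total (F x) 0 with h | h
      · rw [max_eq_right h, max_eq_left (by linarith), abs_of_nonpos h, zero_add]
      · rw [max_eq_left h, max_eq_right (by linarith), abs_of_nonneg h, add_zero]
    simp only [hp, hq, ← this]
    ring
  calc
    _ ≤ ∫ x in (0:ℝ)..T, (|w x| - (p x + q x) + p (x + -ε) + q (x + ε)) := by
      refine intervalIntegral.integral_mono_on hT (Continuous.intervalIntegrable (by fun_prop) _ _)
        (Continuous.intervalIntegrable (by fun_prop) _ _) fun x _ => ?_
      have e : w x + k * (w (x - ε) * max (F (x - ε)) 0 - w x * |F x|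
          + w (x + ε) * max (-F (x + ε)) 0) = w x * (1 - k * |F x|)
          + k * (w (x - ε) * max (F (x - ε)) 0) + k * (w (x + ε) * max (-F (x + ε)) 0) := by ring
      rw [e, hpq]
      refine (abs_add_three _ _ _).trans (le_of_eq ?_)
      simp only [hp, hq, abs_mul, abs_of_nonneg hk, abs_of_nonneg (sub_nonneg.2 (hkF x)),
        abs_of_nonneg (le_max_right _ (0:ℝ)), ← sub_eq_add_neg]
      ring
    _ = (∫ x in (0:ℝ)..T, |w x|) - ((∫ x in (0:ℝ)..T, p x) + ∫ x in (0:ℝ)..T, q x)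
        + (∫ x in (0:ℝ)..T, p (x + -ε)) + ∫ x in (0:ℝ)..T, q (x + ε) := by
      rw [intervalIntegral.integral_add, intervalIntegral.integral_add,
        intervalIntegral.integral_sub, intervalIntegral.integral_add] <;>
      exact Continuous.intervalIntegrable (by fun_prop) _ _
    _ = ∫ x in (0:ℝ)..T, |w x| := by
      rw [integral_periodic_comp_add hpT, integral_periodic_comp_add hqT]
      ring

/-- For a `2π`-periodic solution of the coupled nonlinear discrete transport system with
continuous bounded `f, g`, the `L¹`-norm of `u` on a period is nonincreasing:
`∫₀^{2π}|u(x,t)|dx ≤ ∫₀^{2π}|u(x,0)|dx` for all `t ≥ 0`. -/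
theorem stmt16 (ε : ℝ) (hε : 0 < ε)
    (f g : ℝ × ℝ → ℝ) (hf_cont : Continuous f) (hg_cont : Continuous g)
    (hf_bdd : ∃ M : ℝ, ∀ p : ℝ × ℝ, |f p| ≤ M)
    (hg_bdd : ∃ M : ℝ, ∀ p : ℝ × ℝ, |g p| ≤ M)
    (u v : ℝ → BoundedContinuousFunction ℝ ℝ)
    (hu : ∃ u' v' : ℝ → BoundedContinuousFunction ℝ ℝ,
      ContinuousOn u' (Ici 0) ∧ ContinuousOn v' (Ici 0) ∧
      (∀ t ∈ Ici (0:ℝ), HasDerivWithinAt u (u' t) (Ici 0) t) ∧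
      (∀ t ∈ Ici (0:ℝ), HasDerivWithinAt v (v' t) (Ici 0) t) ∧
      (∀ t ∈ Ici (0:ℝ), ∀ x : ℝ,
        u' t x = ε⁻¹ * (u t (x - ε) * max (f (u t (x - ε), v t (x - ε))) 0
          - u t x * |f (u t x, v t x)|
          + u t (x + ε) * max (-(f (u t (x + ε), v t (x + ε)))) 0)) ∧
      (∀ t ∈ Ici (0:ℝ), ∀ x : ℝ,
        v' t x = ε⁻¹ * (v t (x - ε) * max (g (u t (x - ε), v t (x - ε))) 0
          - v t x * |g (u t x, v t x)|
          + v t (x + ε) * max (-(g (u t (x + ε), v t (x + ε)))) 0)))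
    (hu0_per : ∀ x : ℝ, u 0 (x + 2*π) = u 0 x)
    (hv0_per : ∀ x : ℝ, v 0 (x + 2*π) = v 0 x)
    (hu_per : ∀ t ∈ Ici (0:ℝ), ∀ x : ℝ, u t (x + 2*π) = u t x)
    (hv_per : ∀ t ∈ Ici (0:ℝ), ∀ x : ℝ, v t (x + 2*π) = v t x) :
    ∀ t ∈ Ici (0:ℝ),
      (∫ x in (0:ℝ)..(2*π), |u t x|) ≤ ∫ x in (0:ℝ)..(2*π), |u 0 x| := by
  obtain ⟨u', v', -, -, hu', -, heq, -⟩ := hu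
  obtain ⟨M, hM⟩ := hf_bdd
  have hpi : (0:ℝ) < 2 * π := by positivity
  set E : ℝ → ℝ := fun t => ∫ x in (0:ℝ)..(2*π), |u t x| with hE
  have hEc : ContinuousOn E (Ici 0) := by
    intro t ht
    have h0 : Filter.Tendsto (fun s => 2 * π * ‖u s - u t‖) (nhdsWithin t (Ici 0)) (nhds 0) := by
      have h1 := ((((hu' t ht).continuousWithinAt).sub_const (u t)).norm).const_mul (2 * π)
      simpa [ContinuousWithinAt] using h1
    refine tendsto_iff_dist_tendsto_zero.2
      (squeeze_zero (fun _ => dist_nonneg) (fun s => ?_) h0)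
    rw [Real.dist_eq, abs_le]
    have h2 := integral_abs_le_add_norm_sub (u s) (u t)
    have h3 := integral_abs_le_add_norm_sub (u t) (u s)
    rw [norm_sub_rev] at h3
    constructor <;> simp only [hE] <;> linarith
  intro T hT
  refine image_le_of_liminf_slope_right_le_deriv_boundary (f := E) (a := 0) (b := T)
    (B := fun _ => E 0) (B' := fun _ => 0) (hEc.mono Icc_subset_Ici_self) le_rfl
    continuousOn_const (fun t _ => hasDerivWithinAt_const ..) ?_ ⟨hT, le_rfl⟩
  intro t ht r hr
  have ht0 : t ∈ Ici (0:ℝ) := ht.1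
  refine Filter.Eventually.frequently ?_
  have hd := ((hu' t ht0).mono (fun s hs => ht.1.trans (le_of_lt hs) : Ioi t ⊆ Ici 0)).isLittleO
  have hd' := hd.def (c := r / (4 * π)) (by positivity)
  have hsmall : ∀ᶠ s in nhdsWithin t (Ioi t), (s - t) * (ε⁻¹ * M) < 1 := by
    have hc : Continuous fun s : ℝ => (s - t) * (ε⁻¹ * M) := by fun_prop
    exact (hc.continuousAt.eventually_lt continuousAt_const (by simp)).filter_mono
      nhdsWithin_le_nhds
  filter_upwards [hd', hsmall, self_mem_nhdsWithin] with s hs1 hs2 hs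
  have hst : 0 < s - t := sub_pos.2 hs
  have hstep : (∫ x in (0:ℝ)..(2*π), |(u t + (s - t) • u' t) x|) ≤ E t := by
    have h := integral_abs_upwind_step_le (w := u t) (F := fun x => f (u t x, v t x))
      (T := 2 * π) (k := (s - t) * ε⁻¹) ε hpi.le (u t).continuous
      (hf_cont.comp ((u t).continuous.prodMk (v t).continuous)) (hu_per t ht0)
      (fun x => by simp only [hu_per t ht0 x, hv_per t ht0 x]) (by positivity)
      (fun x => by
        refine le_trans ?_ hs2.le
        rw [← mul_assoc]
        exact mul_le_mul_of_nonneg_left (hM _) (by positivity))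
    simpa [heq t ht0, mul_assoc] using h
  have hrem : ‖u s - (u t + (s - t) • u' t)‖ ≤ r / (4 * π) * (s - t) := by
    rw [Real.norm_of_nonneg hst.le] at hs1
    rwa [← sub_sub]
  have hEs := integral_abs_le_add_norm_sub (u s) (u t + (s - t) • u' t)
  have hmul : 2 * π * ‖u s - (u t + (s - t) • u' t)‖ ≤ r / 2 * (s - t) := by
    calc _ ≤ 2 * π * (r / (4 * π) * (s - t)) := by gcongr
      _ = r / 2 * (s - t) := by field_simp; ring
  rw [slope_def_field, div_lt_iff₀ hst]
  simp only [hE] at hstep ⊢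
  nlinarith
end
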